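/- arXiv:2106.11247 — 5 statements merged into one kernel-verified Lean document; each statement's English description precedes it below -/
import Mathlib

section
/- For every m ∈ ℕ there exists an odd-sized cake 𝒟 with R(𝒟) = m and M(𝒟) = 0; that is, there are odd-sized cakes with arbitrarily many red points on which, with optimal play, Alice obtains all red points. -/
open scoped Classical

noncomputable section

/-- Determinant of the pair of vectors `(q - p, r - p)`. -/
def orientDet (p q r : ℝ × ℝ) : ℝ :=
  (q.1 - p.1) * (r.2 - p.2) - (q.2 - p.2) * (r.1 - p.1)

/-- The orientation `∇ p q r` : `+1` for counterclockwise, `-1` for clockwise, `0` collinear. -/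
def orient (p q r : ℝ × ℝ) : ℝ := Real.sign (orientDet p q r)

/-- A set of points is in general position if no three of its points are collinear. -/
def GenPos (C : Set (ℝ × ℝ)) : Prop :=
  ∀ p ∈ C, ∀ q ∈ C, ∀ r ∈ C, p ≠ q → p ≠ r → q ≠ r → orientDet p q r ≠ 0

/-- The extremal points of a finite set `C`. -/
def exPts (C : Finset (ℝ × ℝ)) : Finset (ℝ × ℝ) :=
  C.filter (fun c => c ∉ convexHull ℝ ((C.erase c : Finset (ℝ × ℝ)) : Set (ℝ × ℝ)))

/-- The minimax value (Bob's total, Alice to move) of the convex grabbing game. -/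
def gameM (w : ℝ × ℝ → ℕ) (C : Finset (ℝ × ℝ)) : ℕ :=
  if h : C.card ≤ 1 then 0
  else
    sInf (↑((exPts C).attach.image (fun a =>
      (exPts (C.erase a.1)).attach.sup (fun b =>
        w b.1 + gameM w ((C.erase a.1).erase b.1)))) : Set ℕ)
termination_by C.card
decreasing_by
  have ha : a.1 ∈ C := Finset.mem_of_mem_filter _ a.2
  have hb : b.1 ∈ C.erase a.1 := Finset.mem_of_mem_filter _ b.2
  calc ((C.erase a.1).erase b.1).card
      < (C.erase a.1).card := Finset.card_erase_lt_of_mem hb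
    _ ≤ C.card := Finset.card_erase_le

/-- The minimax value of the game when it is Bob's turn to move. -/
def gameMB (w : ℝ × ℝ → ℕ) (C : Finset (ℝ × ℝ)) : ℕ :=
  (exPts C).sup (fun b => w b + gameM w (C.erase b))


namespace ConvexGrabbing

open Finset

/-- A point strictly maximizing a linear functional over `insert p A` is not in the hull of `A`. -/
lemma notMem_convexHull_of_forall_lt {A : Set (ℝ × ℝ)} {p : ℝ × ℝ} (a b : ℝ)
    (h : ∀ q ∈ A, a * q.1 + b * q.2 < a * p.1 + b * p.2) : p ∉ convexHull ℝ A := by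
  intro hp
  have hlin : IsLinearMap ℝ (fun q : ℝ × ℝ => a * q.1 + b * q.2) := by
    constructor
    · intro x y
      simp only [Prod.fst_add, Prod.snd_add]
      ring
    · intro c x
      simp only [Prod.smul_fst, Prod.smul_snd, smul_eq_mul]
      ring
  have hsub : convexHull ℝ A ⊆ {q : ℝ × ℝ | a * q.1 + b * q.2 < a * p.1 + b * p.2} :=
    convexHull_min h (convex_halfSpace_lt hlin _)
  exact lt_irrefl (a * p.1 + b * p.2) (hsub hp)

lemma mem_exPts_of_forall_lt {C : Finset (ℝ × ℝ)} {p : ℝ × ℝ} (hp : p ∈ C) (a b : ℝ)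
    (h : ∀ q ∈ C, q ≠ p → a * q.1 + b * q.2 < a * p.1 + b * p.2) : p ∈ exPts C := by
  refine mem_filter.2 ⟨hp, notMem_convexHull_of_forall_lt a b fun q hq => ?_⟩
  have hq' := mem_erase.1 (mem_coe.1 hq)
  exact h q hq'.2 hq'.1

lemma gameM_of_card_le_one (w : ℝ × ℝ → ℕ) {C : Finset (ℝ × ℝ)} (h : C.card ≤ 1) :
    gameM w C = 0 := by
  rw [gameM, dif_pos h]

/-- If Alice has a move after which Bob obtains nothing, the minimax value is zero. -/
lemma gameM_eq_zero_of_gameMB (w : ℝ × ℝ → ℕ) {C : Finset (ℝ × ℝ)} {a : ℝ × ℝ}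
    (ha : a ∈ exPts C) (h : gameMB w (C.erase a) = 0) : gameM w C = 0 := by
  rw [gameM]
  split_ifs with hC
  · rfl
  · rw [Nat.sInf_eq_zero]
    left
    refine mem_coe.2 (mem_image.2 ⟨⟨a, ha⟩, mem_attach _ _, ?_⟩)
    rw [← h, gameMB]
    exact sup_attach (exPts (C.erase a)) (fun b => w b + gameM w ((C.erase a).erase b))

/-- The point at height `t` above the parabola `y = N x²`, at abscissa `i`. -/
def pt (N i t : ℕ) : ℝ × ℝ := ((i : ℝ), (N : ℝ) * (i : ℝ) ^ 2 + (t : ℝ))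

lemma pt_inj {N i t j s : ℕ} : pt N i t = pt N j s ↔ i = j ∧ t = s := by
  constructor
  · intro h
    simp only [pt, Prod.mk.injEq, Nat.cast_inj] at h
    obtain ⟨rfl, h⟩ := h
    exact ⟨rfl, by exact_mod_cast add_left_cancel h⟩
  · rintro ⟨rfl, rfl⟩
    rfl

/-- The elements of `S` that are neither minimal nor maximal. -/
def inner (S : Finset ℕ) : Finset ℕ :=
  S.filter fun i => (∃ a ∈ S, a < i) ∧ ∃ c ∈ S, i < c

lemma mem_inner {S : Finset ℕ} {i : ℕ} :
    i ∈ inner S ↔ i ∈ S ∧ (∃ a ∈ S, a < i) ∧ ∃ c ∈ S, i < c := mem_filter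

/-- Green points on the parabola over `S`, with a red point just above each inner one. -/
def cake (N : ℕ) (S : Finset ℕ) : Finset (ℝ × ℝ) :=
  S.image (fun i => pt N i 0) ∪ (inner S).image (fun i => pt N i 1)

lemma mem_cake {N : ℕ} {S : Finset ℕ} {p : ℝ × ℝ} :
    p ∈ cake N S ↔ (∃ i ∈ S, pt N i 0 = p) ∨ ∃ i ∈ inner S, pt N i 1 = p := by
  simp [cake]

/-- The weight declaring exactly the points off the parabola red. -/
def weight (N : ℕ) (p : ℝ × ℝ) : ℕ := if p.2 = (N : ℝ) * p.1 ^ 2 then 0 else 1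

lemma weight_pt_zero (N i : ℕ) : weight N (pt N i 0) = 0 := by simp [weight, pt]

lemma weight_pt_one (N i : ℕ) : weight N (pt N i 1) = 1 := by simp [weight, pt]

lemma pt_one_mem_convexHull {N a b c : ℕ} (hN : 1 ≤ N) (hab : a < b) (hbc : b < c)
    {A : Set (ℝ × ℝ)} (ha : pt N a 0 ∈ A) (hb : pt N b 0 ∈ A) (hc : pt N c 0 ∈ A) :
    pt N b 1 ∈ convexHull ℝ A := by
  have h1 : (1 : ℝ) ≤ N := by exact_mod_cast hN
  have h2 : (a : ℝ) + 1 ≤ b := by exact_mod_cast hab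
  have h3 : (b : ℝ) + 1 ≤ c := by exact_mod_cast hbc
  have hba : (0 : ℝ) < b - a := by linarith
  have hcb : (0 : ℝ) < c - b := by linarith
  have hca : (0 : ℝ) < c - a := by linarith
  have hN0 : (0 : ℝ) < N := by linarith
  have hprod : (1 : ℝ) ≤ N * ((b - a) * (c - b)) := by
    have : (1 : ℝ) ≤ (b - a) * (c - b) := by nlinarith
    nlinarith
  set s : ℝ := 1 / (N * ((b - a) * (c - b))) with hs
  have hs0 : 0 ≤ s := by positivity
  have hs1 : s ≤ 1 := by
    rw [hs, div_le_one (by linarith)]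
    exact hprod
  have hconv := convex_convexHull ℝ A
  have ha' := subset_convexHull ℝ A ha
  have hb' := subset_convexHull ℝ A hb
  have hc' := subset_convexHull ℝ A hc
  have hchord := hconv ha' hc' (a := (c - b) / (c - a)) (b := (b - a) / (c - a))
    (by positivity) (by positivity) (by field_simp; ring)
  have hfin := hconv hb' hchord (a := 1 - s) (b := s) (by linarith) hs0 (by ring)
  convert hfin using 1
  ext
  · simp only [pt, Prod.fst_add, Prod.smul_fst, smul_eq_mul]
    field_simp
    ring
  · simp only [pt, Prod.snd_add, Prod.smul_snd, smul_eq_mul]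
    have key : (c - b) / (c - a) * (N * (a : ℝ) ^ 2 + ((0 : ℕ) : ℝ))
        + (b - a) / (c - a) * (N * (c : ℝ) ^ 2 + ((0 : ℕ) : ℝ))
        = N * (b : ℝ) ^ 2 + N * ((b - a) * (c - b)) := by
      push_cast
      field_simp
      ring
    rw [key]
    have hs2 : s * (N * ((b - a) * (c - b))) = 1 := by
      rw [hs]
      field_simp
    push_cast
    linear_combination -hs2

/-- Only green points are extremal when Bob is to move. -/
lemma exists_of_mem_exPts_cake {N : ℕ} (hN : 1 ≤ N) {S : Finset ℕ} {p : ℝ × ℝ}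
    (hp : p ∈ exPts (cake N S)) : ∃ j ∈ S, pt N j 0 = p := by
  obtain ⟨hpC, hhull⟩ := mem_filter.1 hp
  rcases mem_cake.1 hpC with h | ⟨b, hb, rfl⟩
  · exact h
  · exfalso
    obtain ⟨hbS, ⟨a, ha, hab⟩, c, hc, hbc⟩ := mem_inner.1 hb
    have hmem : ∀ i ∈ S, pt N i 0 ∈ ((cake N S).erase (pt N b 1) : Finset (ℝ × ℝ)) := by
      intro i hi
      refine mem_erase.2 ⟨fun h => ?_, mem_cake.2 (Or.inl ⟨i, hi, rfl⟩)⟩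
      exact absurd (pt_inj.1 h).2 (by norm_num)
    exact hhull (pt_one_mem_convexHull hN hab hbc (mem_coe.2 (hmem a ha))
      (mem_coe.2 (hmem b hbS)) (mem_coe.2 (hmem c hc)))

lemma cake_erase_erase {N : ℕ} {S : Finset ℕ} {j k : ℕ}
    (h : inner (S.erase j) = (inner S).erase k) :
    ((cake N S).erase (pt N j 0)).erase (pt N k 1) = cake N (S.erase j) := by
  ext p
  simp only [mem_erase, mem_cake, h]
  constructor
  · rintro ⟨h1, h2, ⟨i, hi, rfl⟩ | ⟨i, hi, rfl⟩⟩
    · exact Or.inl ⟨i, ⟨fun e => h2 (by rw [e]), hi⟩, rfl⟩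
    · exact Or.inr ⟨i, ⟨fun e => h1 (by rw [e]), hi⟩, rfl⟩
  · rintro (⟨i, ⟨h1, h2⟩, rfl⟩ | ⟨i, ⟨h1, h2⟩, rfl⟩)
    · exact ⟨fun e => by simp [pt_inj] at e, fun e => h1 (pt_inj.1 e).1, Or.inl ⟨i, h2, rfl⟩⟩
    · exact ⟨fun e => h1 (pt_inj.1 e).1, fun e => by simp [pt_inj] at e, Or.inr ⟨i, h2, rfl⟩⟩

/-- To check that a red point is extremal after a green point was removed, compare it with
all remaining points using a linear functional. -/
lemma mem_exPts_erase {N : ℕ} {S : Finset ℕ} {j k : ℕ} (hk : k ∈ inner S) (a b : ℝ)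
    (h : ∀ i ∈ S, ∀ t : ℕ, t ≤ 1 → (t = 0 → i ≠ j) → (t = 1 → i ≠ k ∧ i ∈ inner S) →
      a * (i : ℝ) + b * (N * (i : ℝ) ^ 2 + (t : ℝ)) <
        a * (k : ℝ) + b * (N * (k : ℝ) ^ 2 + 1)) :
    pt N k 1 ∈ exPts ((cake N S).erase (pt N j 0)) := by
  refine mem_exPts_of_forall_lt
    (mem_erase.2 ⟨fun e => by simp [pt_inj] at e, mem_cake.2 (Or.inr ⟨k, hk, rfl⟩)⟩) a b ?_
  intro q hq hne
  obtain ⟨hq1, hq2⟩ := mem_erase.1 hq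
  rcases mem_cake.1 hq2 with ⟨i, hi, rfl⟩ | ⟨i, hi, rfl⟩
  · have := h i hi 0 (by norm_num) (fun _ e => hq1 (by rw [e])) (by norm_num)
    simpa [pt] using this
  · have := h i (mem_inner.1 hi).1 1 le_rfl (by norm_num)
      (fun _ => ⟨fun e => hne (by rw [e]), hi⟩)
    simpa [pt] using this

/-- Removing a green point exposes a red point whose removal restores the shape of the cake. -/
lemma exists_reply {N : ℕ} (hN : 2 ≤ N) {S : Finset ℕ} {j : ℕ} (hj : j ∈ S)
    (hS : 3 ≤ S.card) :
    ∃ k ∈ inner S, inner (S.erase j) = (inner S).erase k ∧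
      pt N k 1 ∈ exPts ((cake N S).erase (pt N j 0)) := by
  have hN' : (2 : ℝ) ≤ N := by exact_mod_cast hN
  have hT2 : 2 ≤ (S.erase j).card := by
    rw [card_erase_of_mem hj]
    omega
  have hTne : (S.erase j).Nonempty := card_pos.1 (by omega)
  obtain ⟨x, hx, y, hy, hxy⟩ := one_lt_card.1 (show 1 < (S.erase j).card by omega)
  by_cases hlow : ∃ a ∈ S, a < j
  · by_cases hhigh : ∃ c ∈ S, j < c
    · -- the removed point is an inner one
      refine ⟨j, mem_inner.2 ⟨hj, hlow, hhigh⟩, ?_, ?_⟩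
      · obtain ⟨a, ha, haj⟩ := hlow
        obtain ⟨c, hc, hjc⟩ := hhigh
        ext i
        simp only [mem_inner, mem_erase]
        constructor
        · rintro ⟨⟨h1, h2⟩, ⟨a', h3, h4⟩, c', h5, h6⟩
          exact ⟨h1, h2, ⟨a', h3.2, h4⟩, c', h5.2, h6⟩
        · rintro ⟨h1, h2, ⟨a', h3, h4⟩, c', h5, h6⟩
          refine ⟨⟨h1, h2⟩, ?_, ?_⟩
          · by_cases e : a' = j
            · exact ⟨a, ⟨by omega, ha⟩, by omega⟩
            · exact ⟨a', ⟨e, h3⟩, h4⟩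
          · by_cases e : c' = j
            · exact ⟨c, ⟨by omega, hc⟩, by omega⟩
            · exact ⟨c', ⟨e, h5⟩, h6⟩
      · refine mem_exPts_erase (mem_inner.2 ⟨hj, hlow, hhigh⟩) (2 * N * j) (-1) ?_
        intro i hi t ht h0 h1
        have hij : i ≠ j := by
          rcases Nat.le_one_iff_eq_zero_or_eq_one.1 ht with e | e
          · exact h0 e
          · exact (h1 e).1
        have hsq : (1 : ℝ) ≤ ((i : ℝ) - j) ^ 2 := by
          have : (1 : ℤ) ≤ ((i : ℤ) - j) ^ 2 := by
            have : ((i : ℤ) - j) ≠ 0 := by omega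
            have := sq_pos_of_ne_zero this
            omega
          exact_mod_cast this
        have ht0 : (0 : ℝ) ≤ t := Nat.cast_nonneg t
        nlinarith
    · -- the removed point is the rightmost one
      push Not at hhigh
      set k := (S.erase j).max' hTne with hk
      have hkmem : k ∈ S.erase j := max'_mem _ _
      have hkmax : ∀ i ∈ S, i ≠ j → i ≤ k := fun i hi hne => le_max' _ _ (mem_erase.2 ⟨hne, hi⟩)
      have hkS := (mem_erase.1 hkmem).2
      have hkj : k < j := lt_of_le_of_ne (hhigh k hkS) (mem_erase.1 hkmem).1
      have hkin : k ∈ inner S := by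
        refine mem_inner.2 ⟨hkS, ?_, j, hj, hkj⟩
        rw [mem_erase] at hx hy
        have h1 := hkmax x hx.2 hx.1
        have h2 := hkmax y hy.2 hy.1
        rcases lt_or_gt_of_ne hxy with h | h
        · exact ⟨x, hx.2, by omega⟩
        · exact ⟨y, hy.2, by omega⟩
      refine ⟨k, hkin, ?_, ?_⟩
      · ext i
        simp only [mem_inner, mem_erase]
        constructor
        · rintro ⟨⟨h1, h2⟩, ⟨a', h3, h4⟩, c', h5, h6⟩
          have := hkmax c' h5.2 h5.1
          exact ⟨by omega, h2, ⟨a', h3.2, h4⟩, c', h5.2, h6⟩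
        · rintro ⟨h1, h2, ⟨a', h3, h4⟩, c', h5, h6⟩
          have := hhigh c' h5
          have := hhigh i h2
          have hik := hkmax i h2 (by omega)
          exact ⟨⟨by omega, h2⟩, ⟨a', ⟨by omega, h3⟩, h4⟩, k, ⟨by omega, hkS⟩, by omega⟩
      · refine mem_exPts_erase hkin 0 1 ?_
        intro i hi t ht h0 h1
        rcases Nat.le_one_iff_eq_zero_or_eq_one.1 ht with rfl | rfl
        · have hik : (i : ℝ) ≤ k := by exact_mod_cast hkmax i hi (h0 rfl)
          have : (i : ℝ) ^ 2 ≤ (k : ℝ) ^ 2 := pow_le_pow_left₀ (Nat.cast_nonneg i) hik 2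
          push_cast
          nlinarith
        · obtain ⟨hne, hin⟩ := h1 rfl
          obtain ⟨-, -, c, hc, hic⟩ := mem_inner.1 hin
          have := hhigh c hc
          have := hkmax i hi (by omega)
          have hik : (i : ℝ) < k := by exact_mod_cast (show i < k by omega)
          have : (i : ℝ) ^ 2 < (k : ℝ) ^ 2 := pow_lt_pow_left₀ hik (Nat.cast_nonneg i) two_ne_zero
          push_cast
          nlinarith
  · -- the removed point is the leftmost one
    push Not at hlow
    set k := (S.erase j).min' hTne with hk
    have hkmem : k ∈ S.erase j := min'_mem _ _
    have hkmin : ∀ i ∈ S, i ≠ j → k ≤ i := fun i hi hne => min'_le _ _ (mem_erase.2 ⟨hne, hi⟩)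
    have hkS := (mem_erase.1 hkmem).2
    have hkj : j < k := lt_of_le_of_ne (hlow k hkS) (mem_erase.1 hkmem).1.symm
    have hkin : k ∈ inner S := by
      refine mem_inner.2 ⟨hkS, ⟨j, hj, hkj⟩, ?_⟩
      rw [mem_erase] at hx hy
      have h1 := hkmin x hx.2 hx.1
      have h2 := hkmin y hy.2 hy.1
      rcases lt_or_gt_of_ne hxy with h | h
      · exact ⟨y, hy.2, by omega⟩
      · exact ⟨x, hx.2, by omega⟩
    refine ⟨k, hkin, ?_, ?_⟩
    · ext i
      simp only [mem_inner, mem_erase]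
      constructor
      · rintro ⟨⟨h1, h2⟩, ⟨a', h3, h4⟩, c', h5, h6⟩
        have := hkmin a' h3.2 h3.1
        exact ⟨by omega, h2, ⟨a', h3.2, h4⟩, c', h5.2, h6⟩
      · rintro ⟨h1, h2, ⟨a', h3, h4⟩, c', h5, h6⟩
        have := hlow a' h3
        have hik := hkmin i h2 (by omega)
        exact ⟨⟨by omega, h2⟩, ⟨k, ⟨by omega, hkS⟩, by omega⟩, c', ⟨by omega, h5⟩, h6⟩
    · obtain ⟨M, hM⟩ := S.exists_nat_subset_range
      refine mem_exPts_erase hkin (-(2 * N * M + 1)) 1 ?_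
      intro i hi t ht h0 h1
      have hiM : (i : ℝ) ≤ M := by exact_mod_cast (mem_range.1 (hM hi)).le
      have hkM : (k : ℝ) ≤ M := by exact_mod_cast (mem_range.1 (hM hkS)).le
      rcases Nat.le_one_iff_eq_zero_or_eq_one.1 ht with rfl | rfl
      · have hik : (k : ℝ) ≤ i := by exact_mod_cast hkmin i hi (h0 rfl)
        have : 0 ≤ (N : ℝ) * (((i : ℝ) - k) * (2 * M - i - k)) :=
          mul_nonneg (by linarith) (mul_nonneg (by linarith) (by linarith))
        push_cast
        nlinarith
      · obtain ⟨hne, hin⟩ := h1 rfl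
        obtain ⟨-, ⟨a, ha, hai⟩, -⟩ := mem_inner.1 hin
        have := hlow a ha
        have := hkmin i hi (by omega)
        have hik : (k : ℝ) < i := by exact_mod_cast (show k < i by omega)
        have : 0 ≤ (N : ℝ) * (((i : ℝ) - k) * (2 * M - i - k)) :=
          mul_nonneg (by linarith) (mul_nonneg (by linarith) (by linarith))
        push_cast
        nlinarith

lemma inner_eq_empty_of_card_le_two {S : Finset ℕ} (hS : S.card ≤ 2) : inner S = ∅ := by
  refine eq_empty_of_forall_notMem fun i hi => ?_
  obtain ⟨hiS, ⟨a, ha, hai⟩, c, hc, hic⟩ := mem_inner.1 hi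
  have : 2 < S.card := two_lt_card.2 ⟨a, ha, i, hiS, c, hc, by omega, by omega, by omega⟩
  omega

/-- With Bob to move, he obtains nothing from `cake N S`. -/
lemma gameMB_cake {N : ℕ} (hN : 2 ≤ N) (S : Finset ℕ) :
    gameMB (weight N) (cake N S) = 0 := by
  induction S using Finset.strongInduction with
  | H S ih =>
    refine Nat.le_zero.1 (Finset.sup_le fun p hp => ?_)
    obtain ⟨j, hj, rfl⟩ := exists_of_mem_exPts_cake (by omega) hp
    rw [weight_pt_zero, zero_add, Nat.le_zero]
    by_cases hS : 3 ≤ S.card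
    · obtain ⟨k, -, hinner, hex⟩ := exists_reply hN hj hS
      refine gameM_eq_zero_of_gameMB _ hex ?_
      rw [cake_erase_erase hinner]
      exact ih _ (erase_ssubset hj)
    · refine gameM_of_card_le_one _ ?_
      have hcard : (cake N S).card ≤ 2 := by
        rw [cake, inner_eq_empty_of_card_le_two (by omega), image_empty, union_empty]
        exact card_image_le.trans (by omega)
      rw [card_erase_of_mem (mem_cake.2 (Or.inl ⟨j, hj, rfl⟩))]
      omega

lemma orientDet_pt_ne_zero {M i j k t s u : ℕ} (hi : i ≤ M) (hj : j ≤ M) (hk : k ≤ M)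
    (ht : t ≤ 1) (hs : s ≤ 1) (hu : u ≤ 1) (hpq : (i, t) ≠ (j, s)) (hpr : (i, t) ≠ (k, u))
    (hqr : (j, s) ≠ (k, u)) :
    orientDet (pt (2 * M + 1) i t) (pt (2 * M + 1) j s) (pt (2 * M + 1) k u) ≠ 0 := by
  intro h
  have hz : ((2 * M + 1 : ℕ) : ℤ) * (((j : ℤ) - i) * (k - i) * (k - j)) +
      (((j : ℤ) - i) * (u - t) - (s - t) * (k - i)) = 0 := by
    have : ((2 * M + 1 : ℕ) : ℝ) * (((j : ℝ) - i) * (k - i) * (k - j)) +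
        (((j : ℝ) - i) * (u - t) - (s - t) * (k - i)) = 0 := by
      rw [← h]
      simp only [orientDet, pt]
      ring
    exact_mod_cast this
  set e : ℤ := ((j : ℤ) - i) * (u - t) - (s - t) * (k - i) with he
  have hbound : |e| < ((2 * M + 1 : ℕ) : ℤ) := by
    have h1 : |((j : ℤ) - i) * (u - t)| ≤ M * 1 := by
      rw [abs_mul]
      exact mul_le_mul (abs_le.2 ⟨by omega, by omega⟩) (abs_le.2 ⟨by omega, by omega⟩)
        (abs_nonneg _) (by omega)
    have h2 : |((s : ℤ) - t) * (k - i)| ≤ 1 * M := by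
      rw [abs_mul]
      exact mul_le_mul (abs_le.2 ⟨by omega, by omega⟩) (abs_le.2 ⟨by omega, by omega⟩)
        (abs_nonneg _) (by omega)
    have h3 := abs_sub (((j : ℤ) - i) * (u - t)) (((s : ℤ) - t) * (k - i))
    push_cast
    linarith
  have hdvd : ((2 * M + 1 : ℕ) : ℤ) ∣ e :=
    ⟨-(((j : ℤ) - i) * (k - i) * (k - j)), by linear_combination hz⟩
  have he0 : e = 0 := Int.eq_zero_of_abs_lt_dvd hdvd hbound
  rw [he0, add_zero] at hz
  have hM : ((2 * M + 1 : ℕ) : ℤ) ≠ 0 := by omega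
  rw [he] at he0
  simp only [ne_eq, Prod.mk.injEq, not_and] at hpq hpr hqr
  rcases mul_eq_zero.1 ((mul_eq_zero.1 hz).resolve_left hM) with h' | h'
  · rcases mul_eq_zero.1 h' with h' | h'
    · have hts := hpq (by omega)
      rw [h', zero_mul, zero_sub, neg_eq_zero] at he0
      rcases mul_eq_zero.1 he0 with h'' | h''
      · omega
      · have := hpr (by omega)
        have := hqr (by omega)
        omega
    · have := hpr (by omega)
      rw [h', mul_zero, sub_zero] at he0
      rcases mul_eq_zero.1 he0 with h'' | h''
      · have := hpq (by omega)
        have := hqr (by omega)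
        omega
      · omega
  · have := hqr (by omega)
    have hjk : (j : ℤ) = k := by omega
    have he1 : ((k : ℤ) - i) * (u - s) = 0 := by
      rw [hjk] at he0
      linear_combination he0
    rcases mul_eq_zero.1 he1 with h'' | h''
    · have := hpr (by omega)
      have := hpq (by omega)
      omega
    · omega

lemma inner_Icc (m : ℕ) : inner (Icc 1 (m + 2)) = Icc 2 (m + 1) := by
  ext i
  simp only [mem_inner, mem_Icc]
  constructor
  · rintro ⟨h, ⟨a, ha, hai⟩, c, hc, hic⟩
    omega
  · intro h
    exact ⟨by omega, ⟨1, by omega, by omega⟩, m + 2, by omega, by omega⟩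

lemma card_cake (N : ℕ) (S : Finset ℕ) : (cake N S).card = S.card + (inner S).card := by
  rw [cake, card_union_of_disjoint, card_image_of_injective, card_image_of_injective]
  · exact fun i j h => (pt_inj.1 h).1
  · exact fun i j h => (pt_inj.1 h).1
  · rw [disjoint_left]
    intro p hp hq
    obtain ⟨i, -, rfl⟩ := mem_image.1 hp
    obtain ⟨j, -, hj⟩ := mem_image.1 hq
    exact absurd (pt_inj.1 hj).2 (by norm_num)

end ConvexGrabbing

open ConvexGrabbing in
/-- For every `m ∈ ℕ` there exists an odd-sized cake `𝒟` with `R(𝒟) = m`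
and `M(𝒟) = 0`: with optimal play Alice obtains all red points. -/
theorem statement10 (m : ℕ) :
    ∃ (D : Finset (ℝ × ℝ)) (w : ℝ × ℝ → ℕ),
      (∀ p, w p ≤ 1) ∧ GenPos (↑D : Set (ℝ × ℝ)) ∧ Odd D.card ∧
      (D.filter (fun p => w p = 1)).card = m ∧
      gameM w D = 0 := by
  set N := 2 * (m + 2) + 1 with hN
  set S := Finset.Icc 1 (m + 2) with hS
  have h0 : pt N 0 0 ∉ cake N S := by
    intro h
    rcases mem_cake.1 h with ⟨i, hi, e⟩ | ⟨i, hi, e⟩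
    · have := (pt_inj.1 e).1
      have := Finset.mem_Icc.1 hi
      omega
    · exact absurd (pt_inj.1 e).2 (by norm_num)
  have hform : ∀ p ∈ insert (pt N 0 0) (cake N S), ∃ i t, i ≤ m + 2 ∧ t ≤ 1 ∧ p = pt N i t := by
    intro p hp
    rcases Finset.mem_insert.1 hp with rfl | hp
    · exact ⟨0, 0, by omega, by omega, rfl⟩
    · rcases mem_cake.1 hp with ⟨i, hi, rfl⟩ | ⟨i, hi, rfl⟩
      · exact ⟨i, 0, (Finset.mem_Icc.1 hi).2, by omega, rfl⟩
      · exact ⟨i, 1, (Finset.mem_Icc.1 (mem_inner.1 hi).1).2, le_rfl, rfl⟩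
  refine ⟨insert (pt N 0 0) (cake N S), weight N, ?_, ?_, ?_, ?_, ?_⟩
  · intro p
    unfold weight
    split_ifs <;> omega
  · intro p hp q hq r hr hpq hpr hqr
    obtain ⟨i, t, hi, ht, rfl⟩ := hform p (Finset.mem_coe.1 hp)
    obtain ⟨j, s, hj, hs, rfl⟩ := hform q (Finset.mem_coe.1 hq)
    obtain ⟨k, u, hk, hu, rfl⟩ := hform r (Finset.mem_coe.1 hr)
    rw [Ne, pt_inj, ← Prod.mk.injEq] at hpq hpr hqr
    exact orientDet_pt_ne_zero hi hj hk ht hs hu hpq hpr hqr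
  · rw [Finset.card_insert_of_notMem h0, card_cake, inner_Icc, Nat.card_Icc, Nat.card_Icc]
    exact ⟨m + 1, by omega⟩
  · have hred : (insert (pt N 0 0) (cake N S)).filter (fun p => weight N p = 1) =
        (Finset.Icc 2 (m + 1)).image (fun i => pt N i 1) := by
      ext p
      rw [Finset.mem_filter, Finset.mem_insert, mem_cake, Finset.mem_image, inner_Icc]
      constructor
      · rintro ⟨rfl | ⟨i, -, rfl⟩ | h, hw⟩
        · rw [weight_pt_zero] at hw
          omega
        · rw [weight_pt_zero] at hw
          omega
        · exact h
      · rintro ⟨i, hi, rfl⟩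
        exact ⟨Or.inr (Or.inr ⟨i, hi, rfl⟩), weight_pt_one N i⟩
    rw [hred, Finset.card_image_of_injective _ fun i j h => (pt_inj.1 h).1, Nat.card_Icc]
    omega
  · refine gameM_eq_zero_of_gameMB (a := pt N 0 0) _ ?_ ?_
    · refine mem_exPts_of_forall_lt (Finset.mem_insert_self _ _) (-1) 0 ?_
      intro q hq hne
      have hpos : ∃ i t, 1 ≤ i ∧ q = pt N i t := by
        rcases mem_cake.1 (Finset.mem_of_mem_insert_of_ne hq hne) with ⟨i, hi, rfl⟩ | ⟨i, hi, rfl⟩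
        · exact ⟨i, 0, (Finset.mem_Icc.1 hi).1, rfl⟩
        · exact ⟨i, 1, (Finset.mem_Icc.1 (mem_inner.1 hi).1).1, rfl⟩
      obtain ⟨i, t, hi, rfl⟩ := hpos
      have : (1 : ℝ) ≤ i := by exact_mod_cast hi
      simp only [pt]
      push_cast
      linarith
    · rw [Finset.erase_insert h0]
      exact gameMB_cake (by omega) S

end
end

section
/- Suppose that for every cake C whose extremal set Ex(C) contains a red point, the following two properties hold: (i) there exists a red point a ∈ Ex(C) that is an optimal move for Alice, and (ii) there exists a red point b ∈ Ex(C) that is an optimal move for Bob (the Greedy-move conjecture). Then for every cake C whose extremal set Ex(C) contains a red point, every red point a ∈ Ex(C) is an optimal move for Alice and every red point b ∈ Ex(C) is an optimal move for Bob (the Strong greedy-move conjecture). In other words, the Greedy-move conjecture implies the Strong greedy-move conjecture. -/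
open scoped Classical

noncomputable section

/-- An extremal point stays extremal after another point is removed. -/
theorem mem_exPts_erase {C : Finset (ℝ × ℝ)} {a r : ℝ × ℝ} (hr : r ∈ exPts C) (hra : r ≠ a) :
    r ∈ exPts (C.erase a) := by
  obtain ⟨hrC, hr⟩ := Finset.mem_filter.1 hr
  refine Finset.mem_filter.2 ⟨Finset.mem_erase.2 ⟨hra, hrC⟩, fun h => hr ?_⟩
  exact convexHull_mono
    (Finset.coe_subset.2 (Finset.erase_subset_erase r (Finset.erase_subset a C))) h

theorem mem_of_mem_exPts {C : Finset (ℝ × ℝ)} {a : ℝ × ℝ} (ha : a ∈ exPts C) : a ∈ C :=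
  Finset.mem_of_mem_filter _ ha

theorem GenPos.mono {C D : Set (ℝ × ℝ)} (hD : GenPos D) (h : C ⊆ D) : GenPos C :=
  fun p hp q hq r hr => hD p (h hp) q (h hq) r (h hr)

theorem GenPos.erase {C : Finset (ℝ × ℝ)} (hC : GenPos (↑C : Set (ℝ × ℝ))) (a : ℝ × ℝ) :
    GenPos (↑(C.erase a) : Set (ℝ × ℝ)) :=
  hC.mono (Finset.coe_subset.2 (Finset.erase_subset a C))

/-- The Greedy-move conjecture implies the Strong greedy-move conjecture.
If on every cake with an extremal red point some extremal red point is an optimal move for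
Alice and some extremal red point is an optimal move for Bob, then on every cake with an
extremal red point, every extremal red point is an optimal move for Alice and every
extremal red point is an optimal move for Bob. -/
theorem statement11
    (greedy : ∀ (C : Finset (ℝ × ℝ)) (w : ℝ × ℝ → ℕ), (∀ p, w p ≤ 1) →
      GenPos (↑C : Set (ℝ × ℝ)) → (∃ r ∈ exPts C, w r = 1) →
        (∃ a ∈ exPts C, w a = 1 ∧ gameMB w (C.erase a) = gameM w C) ∧
        (∃ b ∈ exPts C, w b = 1 ∧ w b + gameM w (C.erase b) = gameMB w C)) :
    ∀ (C : Finset (ℝ × ℝ)) (w : ℝ × ℝ → ℕ), (∀ p, w p ≤ 1) →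
      GenPos (↑C : Set (ℝ × ℝ)) → (∃ r ∈ exPts C, w r = 1) →
        (∀ a ∈ exPts C, w a = 1 → gameMB w (C.erase a) = gameM w C) ∧
        (∀ b ∈ exPts C, w b = 1 → w b + gameM w (C.erase b) = gameMB w C) := by
  intro C
  induction C using Finset.strongInduction with
  | H C ih =>
    intro w hw hC hr
    obtain ⟨⟨a', ha', hwa', hopt_a⟩, ⟨b', hb', hwb', hopt_b⟩⟩ := greedy C w hw hC hr
    have bob_takes : ∀ x ∈ exPts C, ∀ y ∈ exPts C, y ≠ x → w y = 1 →
        w y + gameM w ((C.erase x).erase y) = gameMB w (C.erase x) := by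
      intro x hx y hy hyx hwy
      have hy' := mem_exPts_erase hy hyx
      exact (ih _ (Finset.erase_ssubset (mem_of_mem_exPts hx)) w hw (hC.erase x)
        ⟨y, hy', hwy⟩).2 y hy' hwy
    have alice_takes : ∀ x ∈ exPts C, ∀ y ∈ exPts C, y ≠ x → w y = 1 →
        gameMB w ((C.erase x).erase y) = gameM w (C.erase x) := by
      intro x hx y hy hyx hwy
      have hy' := mem_exPts_erase hy hyx
      exact (ih _ (Finset.erase_ssubset (mem_of_mem_exPts hx)) w hw (hC.erase x)
        ⟨y, hy', hwy⟩).1 y hy' hwy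
    refine ⟨fun a ha hwa => ?_, fun b hb hwb => ?_⟩
    · rcases eq_or_ne a a' with rfl | hne
      · exact hopt_a
      · rw [← hopt_a, ← bob_takes a ha a' ha' hne.symm hwa', ← bob_takes a' ha' a ha hne hwa,
          hwa, hwa', Finset.erase_right_comm]
    · rcases eq_or_ne b b' with rfl | hne
      · exact hopt_b
      · rw [← hopt_b, ← alice_takes b hb b' hb' hne.symm hwb', ← alice_takes b' hb' b hb hne hwb,
          hwb, hwb', Finset.erase_right_comm]

end
end

section
/- There exists a cake C, with Alice to move, such that Ex(C) contains no red point, the set N = {c ∈ Ex(C) | Ex(C \ {c}) contains no red point} of non-revealing moves is nonempty, and yet no move in N is optimal for Alice: for every c ∈ N one has M_B(C \ {c}) > M(C). Hence the No-reveal-move conjecture is false. -/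
open scoped Classical

noncomputable section

/-! ### Extremal points of finite planar sets -/

/-- A point outside the convex hull of a nonempty finite set sees that set from one of its
points counterclockwise. -/
theorem exists_orientDet_nonneg (c : ℝ × ℝ) (T : Finset (ℝ × ℝ)) (hT : T.Nonempty)
    (hc : c ∉ convexHull ℝ (T : Set (ℝ × ℝ))) : ∃ q ∈ T, ∀ r ∈ T, 0 ≤ orientDet c q r := by
  induction hT using Finset.Nonempty.cons_induction with
  | singleton a =>
    refine ⟨a, by simp, fun r hr => ?_⟩
    rw [Finset.mem_singleton.1 hr, orientDet]
    exact le_of_eq (by ring)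
  | cons p T hp hT ih =>
    have hsub : (T : Set (ℝ × ℝ)) ⊆ (Finset.cons p T hp : Finset (ℝ × ℝ)) := by
      intro x hx
      simpa using Or.inr hx
    obtain ⟨q, hq, hqT⟩ := ih fun h => hc (convexHull_mono hsub h)
    rcases le_or_gt 0 (orientDet c q p) with hqp | hqp
    · refine ⟨q, Finset.mem_cons_of_mem hq, fun r hr => ?_⟩
      rcases Finset.mem_cons.1 hr with rfl | hr
      · exact hqp
      · exact hqT r hr
    · refine ⟨p, Finset.mem_cons_self p T, fun r hr => ?_⟩
      rcases Finset.mem_cons.1 hr with rfl | hr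
      · rw [orientDet]
        exact le_of_eq (by ring)
      by_contra! hpr
      refine hc ?_
      have hconv := convex_convexHull ℝ ((Finset.cons p T hp : Finset (ℝ × ℝ)) : Set (ℝ × ℝ))
      have hmem : ∀ x ∈ Finset.cons p T hp,
          x ∈ convexHull ℝ ((Finset.cons p T hp : Finset (ℝ × ℝ)) : Set (ℝ × ℝ)) :=
        fun x hx => subset_convexHull ℝ _ hx
      have hqr := hqT r hr
      set D := orientDet c q r - orientDet c p r - orientDet c q p with hD
      have hDpos : 0 < D := by linarith
      have hsum := hconv.sum_mem (t := Finset.univ)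
        (w := ![orientDet c q r / D, -orientDet c p r / D, -orientDet c q p / D])
        (z := ![p, q, r])
        (by
          intro i _
          fin_cases i
          · exact div_nonneg hqr hDpos.le
          · exact div_nonneg (by linarith) hDpos.le
          · exact div_nonneg (by linarith) hDpos.le)
        (by
          simp only [Fin.sum_univ_three, Matrix.cons_val]
          field_simp
          rw [hD]
          ring)
        (by
          intro i _
          fin_cases i
          · exact hmem p (Finset.mem_cons_self p T)
          · exact hmem q (Finset.mem_cons_of_mem hq)
          · exact hmem r (Finset.mem_cons_of_mem hr))
      convert hsum using 1
      simp only [Fin.sum_univ_three, Matrix.cons_val]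
      ext
      · simp only [Prod.fst_add, Prod.smul_fst, smul_eq_mul]
        field_simp
        rw [hD]
        simp only [orientDet]
        ring
      · simp only [Prod.snd_add, Prod.smul_snd, smul_eq_mul]
        field_simp
        rw [hD]
        simp only [orientDet]
        ring

theorem notMem_convexHull_of_orientDet_pos {c q : ℝ × ℝ} {T : Set (ℝ × ℝ)} (hcq : c ≠ q)
    (h : ∀ r ∈ T, r = q ∨ 0 < orientDet c q r) : c ∉ convexHull ℝ T := by
  intro hc
  have hconv : Convex ℝ {p : ℝ × ℝ | p = q ∨ 0 < orientDet c q p} := by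
    have hq : orientDet c q q = 0 := by rw [orientDet]; ring
    intro x hx y hy a b ha hb hab
    have hlin : orientDet c q (a • x + b • y) = a * orientDet c q x + b * orientDet c q y := by
      obtain rfl : b = 1 - a := by linarith
      simp only [orientDet, Prod.fst_add, Prod.snd_add, Prod.smul_fst, Prod.smul_snd, smul_eq_mul]
      ring
    rcases ha.eq_or_lt with rfl | ha
    · obtain rfl : b = 1 := by linarith
      simpa using hy
    rcases hb.eq_or_lt with rfl | hb
    · obtain rfl : a = 1 := by linarith
      simpa using hx
    rcases hx with rfl | hx <;> rcases hy with rfl | hy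
    · left
      rw [← add_smul, hab, one_smul]
    · right
      rw [hlin, hq]
      positivity
    · right
      rw [hlin, hq]
      positivity
    · right
      rw [hlin]
      positivity
  rcases convexHull_min h hconv hc with h | h
  · exact hcq h
  · rw [orientDet] at h
    simp at h

theorem exPts_nonempty {C : Finset (ℝ × ℝ)} (hC : C.Nonempty) : (exPts C).Nonempty := by
  obtain ⟨x, hx⟩ : ((convexHull ℝ (C : Set (ℝ × ℝ))).extremePoints ℝ).Nonempty :=
    (C.finite_toSet.isCompact_convexHull ℝ).extremePoints_nonempty (by simpa using hC)
  have hxC : x ∈ C := extremePoints_convexHull_subset hx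
  refine ⟨x, Finset.mem_filter.2 ⟨hxC, fun h => ?_⟩⟩
  rw [(convex_convexHull ℝ _).mem_extremePoints_iff_mem_sdiff_convexHull_sdiff] at hx
  refine hx.2 (convexHull_mono ?_ h)
  intro y hy
  rw [Finset.mem_coe, Finset.mem_erase] at hy
  exact ⟨subset_convexHull ℝ _ hy.2, hy.1⟩

/-! ### Unfolding the game -/

theorem gameMB_le_iff {w : ℝ × ℝ → ℕ} {C : Finset (ℝ × ℝ)} {k : ℕ} :
    gameMB w C ≤ k ↔ ∀ b ∈ exPts C, w b + gameM w (C.erase b) ≤ k :=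
  Finset.sup_le_iff

theorem gameM_eq_sInf {w : ℝ × ℝ → ℕ} {C : Finset (ℝ × ℝ)} (hC : 2 ≤ C.card) :
    gameM w C = sInf ((fun a => gameMB w (C.erase a)) '' (exPts C : Set (ℝ × ℝ))) := by
  rw [gameM, dif_neg (by omega)]
  congr 1
  ext n
  simp only [Finset.coe_image, Set.mem_image, Finset.mem_coe, Finset.mem_attach, true_and,
    Subtype.exists, gameMB]
  constructor
  · rintro ⟨a, ha, rfl⟩
    exact ⟨a, ha, (Finset.sup_attach _ fun b => w b + gameM w ((C.erase a).erase b)).symm⟩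
  · rintro ⟨a, ha, rfl⟩
    exact ⟨a, ha, Finset.sup_attach _ fun b => w b + gameM w ((C.erase a).erase b)⟩

theorem gameM_le_iff {w : ℝ × ℝ → ℕ} {C : Finset (ℝ × ℝ)} {k : ℕ} (hC : 2 ≤ C.card) :
    gameM w C ≤ k ↔ ∃ a ∈ exPts C, gameMB w (C.erase a) ≤ k := by
  rw [gameM_eq_sInf hC]
  constructor
  · intro h
    have hne : C.Nonempty := Finset.card_pos.1 (by omega)
    obtain ⟨a, ha, hak⟩ := Nat.sInf_mem
      ((exPts_nonempty hne).to_set.image fun a => gameMB w (C.erase a))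
    exact ⟨a, ha, hak.le.trans h⟩
  · rintro ⟨a, ha, hak⟩
    exact (Nat.sInf_le (Set.mem_image_of_mem _ ha)).trans hak

/-! ### A decidable version of the game on lattice points -/

/-- The inclusion of the integer lattice in the plane. -/
def latticeEmb : ℤ × ℤ ↪ ℝ × ℝ where
  toFun p := (p.1, p.2)
  inj' p q h := by simpa [Prod.ext_iff] using h

theorem latticeEmb_apply (p : ℤ × ℤ) : latticeEmb p = ((p.1 : ℝ), (p.2 : ℝ)) := rfl

/-- The determinant `orientDet` for lattice points. -/
def latticeDet (p q r : ℤ × ℤ) : ℤ :=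
  (q.1 - p.1) * (r.2 - p.2) - (q.2 - p.2) * (r.1 - p.1)

theorem orientDet_latticeEmb (p q r : ℤ × ℤ) :
    orientDet (latticeEmb p) (latticeEmb q) (latticeEmb r) = latticeDet p q r := by
  simp [orientDet, latticeDet, latticeEmb_apply]

/-- No three points of a finite set of lattice points are collinear. -/
def LatticeGenPos (S : Finset (ℤ × ℤ)) : Prop :=
  ∀ p ∈ S, ∀ q ∈ S, ∀ r ∈ S, p ≠ q → p ≠ r → q ≠ r → latticeDet p q r ≠ 0

instance (S : Finset (ℤ × ℤ)) : Decidable (LatticeGenPos S) := by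
  unfold LatticeGenPos
  infer_instance

theorem LatticeGenPos.mono {S T : Finset (ℤ × ℤ)} (hT : LatticeGenPos T) (h : S ⊆ T) :
    LatticeGenPos S :=
  fun p hp q hq r hr => hT p (h hp) q (h hq) r (h hr)

/-- `c` is separated from the other points of `S` by a line, witnessed by a line through `c` and
another point of `S`. -/
def IsVertex (S : Finset (ℤ × ℤ)) (c : ℤ × ℤ) : Prop :=
  S.erase c = ∅ ∨ ∃ q ∈ S.erase c, ∀ r ∈ S.erase c, r = q ∨ 0 < latticeDet c q r

instance (S : Finset (ℤ × ℤ)) (c : ℤ × ℤ) : Decidable (IsVertex S c) := by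
  unfold IsVertex
  infer_instance

theorem latticeEmb_mem_exPts {S : Finset (ℤ × ℤ)} (hS : LatticeGenPos S) {c : ℤ × ℤ} :
    latticeEmb c ∈ exPts (S.map latticeEmb) ↔ c ∈ S ∧ IsVertex S c := by
  rw [exPts, Finset.mem_filter, Finset.mem_map', ← Finset.map_erase]
  refine and_congr_right fun hc => ⟨fun h => ?_, ?_⟩
  · rcases (S.erase c).eq_empty_or_nonempty with hempty | hne
    · exact Or.inl hempty
    obtain ⟨q', hq', hr'⟩ := exists_orientDet_nonneg _ _ (hne.map (f := latticeEmb)) h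
    obtain ⟨q, hq, rfl⟩ := Finset.mem_map.1 hq'
    refine Or.inr ⟨q, hq, fun r hr => or_iff_not_imp_left.2 fun hrq => ?_⟩
    have hnonneg := hr' _ (Finset.mem_map_of_mem latticeEmb hr)
    rw [orientDet_latticeEmb, Int.cast_nonneg_iff] at hnonneg
    rw [Finset.mem_erase] at hq hr
    exact lt_of_le_of_ne hnonneg
      (hS c hc q hq.2 r hr.2 hq.1.symm hr.1.symm (Ne.symm hrq)).symm
  · rintro (hempty | ⟨q, hq, hr⟩)
    · simp [hempty]
    · refine notMem_convexHull_of_orientDet_pos (q := latticeEmb q)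
        (latticeEmb.injective.ne (Finset.ne_of_mem_erase hq).symm) fun r' hr' => ?_
      obtain ⟨r, hrS, rfl⟩ := Finset.mem_map.1 (Finset.mem_coe.1 hr')
      rcases hr r hrS with rfl | hpos
      · exact Or.inl rfl
      · right
        rw [orientDet_latticeEmb]
        exact_mod_cast hpos

theorem exists_mem_exPts_map {S : Finset (ℤ × ℤ)} (hS : LatticeGenPos S) {P : ℝ × ℝ → Prop} :
    (∃ c ∈ exPts (S.map latticeEmb), P c) ↔ ∃ c ∈ S, IsVertex S c ∧ P (latticeEmb c) := by
  constructor
  · rintro ⟨c', hc', hP⟩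
    obtain ⟨c, -, rfl⟩ := Finset.mem_map.1 (Finset.mem_of_mem_filter _ hc')
    obtain ⟨hc, hv⟩ := (latticeEmb_mem_exPts hS).1 hc'
    exact ⟨c, hc, hv, hP⟩
  · rintro ⟨c, hc, hv, hP⟩
    exact ⟨_, (latticeEmb_mem_exPts hS).2 ⟨hc, hv⟩, hP⟩

theorem forall_mem_exPts_map {S : Finset (ℤ × ℤ)} (hS : LatticeGenPos S) {P : ℝ × ℝ → Prop} :
    (∀ c ∈ exPts (S.map latticeEmb), P c) ↔ ∀ c ∈ S, IsVertex S c → P (latticeEmb c) := by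
  have h := (exists_mem_exPts_map hS (P := fun c => ¬P c)).not
  push Not at h
  exact h

/-- The weight of a lattice point when the red points are those of `R`. -/
def redWeight (R : Finset (ℤ × ℤ)) (p : ℤ × ℤ) : ℕ := if p ∈ R then 1 else 0

/-- The weight function on the plane whose red points are those of `R`. -/
def planeWeight (R : Finset (ℤ × ℤ)) (p : ℝ × ℝ) : ℕ := if p ∈ R.map latticeEmb then 1 else 0

theorem planeWeight_latticeEmb (R : Finset (ℤ × ℤ)) (p : ℤ × ℤ) :
    planeWeight R (latticeEmb p) = redWeight R p := by
  simp [planeWeight, redWeight]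

/-- With `2 * n + 1` points left and Alice to move, Alice can hold Bob to at most `k` of the red
points `R`. -/
def BobAtMost (R : Finset (ℤ × ℤ)) : ℕ → ℕ → Finset (ℤ × ℤ) → Prop
  | 0, _, _ => True
  | n + 1, k, S => ∃ a ∈ S, IsVertex S a ∧ ∀ b ∈ S.erase a, IsVertex (S.erase a) b →
      redWeight R b ≤ k ∧ BobAtMost R n (k - redWeight R b) ((S.erase a).erase b)

instance BobAtMost.decidable (R : Finset (ℤ × ℤ)) :
    ∀ (n k : ℕ) (S : Finset (ℤ × ℤ)), Decidable (BobAtMost R n k S)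
  | 0, _, _ => isTrue trivial
  | n + 1, k, S =>
    have := BobAtMost.decidable R n
    inferInstanceAs (Decidable (∃ a ∈ S, IsVertex S a ∧ ∀ b ∈ S.erase a,
      IsVertex (S.erase a) b →
        redWeight R b ≤ k ∧ BobAtMost R n (k - redWeight R b) ((S.erase a).erase b)))

theorem gameM_map_le_iff (R : Finset (ℤ × ℤ)) (n k : ℕ) (S : Finset (ℤ × ℤ))
    (hS : LatticeGenPos S) (hcard : S.card = 2 * n + 1) :
    gameM (planeWeight R) (S.map latticeEmb) ≤ k ↔ BobAtMost R n k S := by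
  induction n generalizing k S with
  | zero =>
    rw [gameM, dif_pos (by rw [Finset.card_map]; omega)]
    simp [BobAtMost]
  | succ n ih =>
    rw [gameM_le_iff (by rw [Finset.card_map]; omega), exists_mem_exPts_map hS, BobAtMost]
    refine exists_congr fun a => and_congr_right fun ha => and_congr_right fun _ => ?_
    have hSa := hS.mono (S.erase_subset a)
    rw [gameMB_le_iff, ← Finset.map_erase, forall_mem_exPts_map hSa]
    refine forall_congr' fun b => forall_congr' fun hb => imp_congr_right fun _ => ?_
    rw [← Finset.map_erase, planeWeight_latticeEmb, ← ih _ _ (hSa.mono (Finset.erase_subset b _))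
      (by rw [Finset.card_erase_of_mem hb, Finset.card_erase_of_mem ha]; omega)]
    omega

theorem gameMB_map_le_iff (R : Finset (ℤ × ℤ)) (n k : ℕ) (S : Finset (ℤ × ℤ))
    (hS : LatticeGenPos S) (hcard : S.card = 2 * n + 2) :
    gameMB (planeWeight R) (S.map latticeEmb) ≤ k ↔ ∀ b ∈ S, IsVertex S b →
      redWeight R b ≤ k ∧ BobAtMost R n (k - redWeight R b) (S.erase b) := by
  rw [gameMB_le_iff, forall_mem_exPts_map hS]
  refine forall_congr' fun b => forall_congr' fun hb => imp_congr_right fun _ => ?_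
  rw [← Finset.map_erase, planeWeight_latticeEmb, ← gameM_map_le_iff R n _ _
    (hS.mono (Finset.erase_subset b _)) (by rw [Finset.card_erase_of_mem hb]; omega)]
  omega

/-! ### The counterexample -/

/-- The red points of the counterexample. -/
def redPoints : Finset (ℤ × ℤ) := {(9, 3), (6, 7), (7, 8), (4, 7)}

/-- The nine points of the counterexample. -/
def cakePoints : Finset (ℤ × ℤ) :=
  {(9, 3), (6, 7), (7, 8), (11, 2), (4, 7), (0, 4), (7, 11), (8, 2), (6, 9)}

theorem latticeGenPos_cakePoints : LatticeGenPos cakePoints := by decide +kernel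

/-- The No-reveal-move conjecture is false: there is a cake `C` (Alice to
move) with no extremal red point, whose set `N` of non-revealing moves is nonempty, and
yet every move in `N` is strictly suboptimal for Alice. -/
theorem statement12 :
    ∃ (C : Finset (ℝ × ℝ)) (w : ℝ × ℝ → ℕ),
      (∀ p, w p ≤ 1) ∧ GenPos (↑C : Set (ℝ × ℝ)) ∧
      (∀ r ∈ exPts C, w r ≠ 1) ∧
      (∃ c ∈ exPts C, ∀ r ∈ exPts (C.erase c), w r ≠ 1) ∧
      (∀ c ∈ exPts C, (∀ r ∈ exPts (C.erase c), w r ≠ 1) →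
        gameM w C < gameMB w (C.erase c)) := by
  have hgen := latticeGenPos_cakePoints
  have herase (c : ℤ × ℤ) := hgen.mono (cakePoints.erase_subset c)
  refine ⟨cakePoints.map latticeEmb, planeWeight redPoints, ?_, ?_, ?_, ?_, ?_⟩
  · intro p
    unfold planeWeight
    split_ifs <;> simp
  · intro p' hp' q' hq' r' hr' hpq hpr hqr
    obtain ⟨p, hp, rfl⟩ := Finset.mem_map.1 (Finset.mem_coe.1 hp')
    obtain ⟨q, hq, rfl⟩ := Finset.mem_map.1 (Finset.mem_coe.1 hq')
    obtain ⟨r, hr, rfl⟩ := Finset.mem_map.1 (Finset.mem_coe.1 hr')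
    rw [orientDet_latticeEmb, Int.cast_ne_zero]
    exact hgen p hp q hq r hr (ne_of_apply_ne _ hpq) (ne_of_apply_ne _ hpr) (ne_of_apply_ne _ hqr)
  · simp only [forall_mem_exPts_map hgen, planeWeight_latticeEmb]
    decide +kernel
  · simp only [exists_mem_exPts_map hgen, ← Finset.map_erase, forall_mem_exPts_map (herase _),
      planeWeight_latticeEmb]
    decide +kernel
  · simp only [forall_mem_exPts_map hgen, ← Finset.map_erase, forall_mem_exPts_map (herase _),
      planeWeight_latticeEmb]
    have hM : gameM (planeWeight redPoints) (cakePoints.map latticeEmb) ≤ 1 :=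
      (gameM_map_le_iff redPoints 4 1 cakePoints hgen (by decide)).2 (by decide +kernel)
    intro c hc hv hN
    refine hM.trans_lt (lt_of_not_ge ?_)
    rw [gameMB_map_le_iff redPoints 3 1 _ (herase c)
      (by rw [Finset.card_erase_of_mem hc]; decide)]
    revert c
    decide +kernel

end
end

section
/- For every integer n ≥ 2 and every admissible ε, the extremal points of the moon are exactly its green points: Ex(𝓛ₙ) = {g_0, g_1, …, g_n}. Equivalently, each of the n − 1 red points r_j lies in the convex hull of the remaining points of 𝓛ₙ, while none of the n + 1 green points g_j lies in the convex hull of the remaining points. -/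
open scoped Classical

noncomputable section

/-- The `j`-th green point of the moon with `n` rays. -/
def gPt (n j : ℕ) : ℝ × ℝ :=
  (Real.cos (j * Real.pi / n), -Real.sin (j * Real.pi / n))

/-- The `j`-th red point of the moon with `n` rays and parameter `ε`. -/
def rPt (n : ℕ) (ε : ℝ) (j : ℕ) : ℝ × ℝ :=
  ((1 - ε) * Real.cos (j * Real.pi / n), -((1 - ε) * Real.sin (j * Real.pi / n)))

/-- The green points of the moon. -/
def moonGreens (n : ℕ) : Finset (ℝ × ℝ) := (Finset.range (n + 1)).image (gPt n)

/-- The red points of the moon. -/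
def moonReds (n : ℕ) (ε : ℝ) : Finset (ℝ × ℝ) := (Finset.Icc 1 (n - 1)).image (rPt n ε)

/-- The point set of the moon `𝓛ₙ`. -/
def moonPts (n : ℕ) (ε : ℝ) : Finset (ℝ × ℝ) := moonGreens n ∪ moonReds n ε

/-- The weight function of the moon: red points have weight 1, everything else 0. -/
def moonW (n : ℕ) (ε : ℝ) : ℝ × ℝ → ℕ := fun p => if p ∈ moonReds n ε then 1 else 0

theorem gPt_norm_sq (n j : ℕ) : (gPt n j).1 ^ 2 + (gPt n j).2 ^ 2 = 1 := by
  simp [gPt]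

theorem rPt_norm_sq (n : ℕ) (ε : ℝ) (j : ℕ) :
    (rPt n ε j).1 ^ 2 + (rPt n ε j).2 ^ 2 = (1 - ε) ^ 2 := by
  simp only [rPt]
  linear_combination (1 - ε) ^ 2 * Real.sin_sq_add_cos_sq (j * Real.pi / n)

/-- A point of the unit circle is not a convex combination of other points of the unit disc. -/
theorem notMem_convexHull_of_unit_circle {c : ℝ × ℝ} (hc : c.1 ^ 2 + c.2 ^ 2 = 1)
    {S : Set (ℝ × ℝ)} (hS : ∀ q ∈ S, q.1 ^ 2 + q.2 ^ 2 ≤ 1) (hcS : c ∉ S) :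
    c ∉ convexHull ℝ S := by
  intro hmem
  let f : ℝ × ℝ →ₗ[ℝ] ℝ := c.1 • LinearMap.fst ℝ ℝ ℝ + c.2 • LinearMap.snd ℝ ℝ ℝ
  have hf (q : ℝ × ℝ) : f q = c.1 * q.1 + c.2 * q.2 := by simp [f]
  have hconv : Convex ℝ {q | f q < 1} := convex_halfSpace_lt f.isLinear 1
  have hsub : S ⊆ {q | f q < 1} := by
    intro q hq
    rw [Set.mem_ofPred_eq, hf]
    by_contra! hge
    have hq1 := hS q hq
    have h1 : q.1 - c.1 = 0 := by nlinarith [sq_nonneg (q.1 - c.1), sq_nonneg (q.2 - c.2)]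
    have h2 : q.2 - c.2 = 0 := by nlinarith [sq_nonneg (q.1 - c.1), sq_nonneg (q.2 - c.2)]
    exact hcS (Prod.ext (sub_eq_zero.mp h1) (sub_eq_zero.mp h2) ▸ hq)
  have h := convexHull_min hsub hconv hmem
  rw [Set.mem_ofPred_eq, hf] at h
  nlinarith

/-- The sum of the two neighbours of a green point is a multiple of that point. -/
theorem gPt_add_gPt {n : ℕ} (hn : n ≠ 0) (j : ℕ) :
    gPt n j + gPt n (j + 2) = (2 * Real.cos (Real.pi / n)) • gPt n (j + 1) := by
  have hn' : (n : ℝ) ≠ 0 := by exact_mod_cast hn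
  have e1 : (j : ℝ) * Real.pi / n = ((j + 1 : ℕ) : ℝ) * Real.pi / n - Real.pi / n := by
    push_cast; ring
  have e2 : ((j + 2 : ℕ) : ℝ) * Real.pi / n = ((j + 1 : ℕ) : ℝ) * Real.pi / n + Real.pi / n := by
    push_cast; ring
  ext
  · simp only [gPt, Prod.fst_add, Prod.smul_fst, smul_eq_mul, e1, e2, Real.cos_sub, Real.cos_add]
    ring
  · simp only [gPt, Prod.snd_add, Prod.smul_snd, smul_eq_mul, e1, e2, Real.sin_sub, Real.sin_add]
    ring

theorem rPt_mem_convexHull {n : ℕ} (hn : n ≠ 0) {ε : ℝ} (hε0 : 0 < ε)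
    (hε : ε < 1 - Real.cos (Real.pi / n)) (j : ℕ) {S : Set (ℝ × ℝ)}
    (h0 : gPt n j ∈ S) (h1 : gPt n (j + 1) ∈ S) (h2 : gPt n (j + 2) ∈ S) :
    rPt n ε (j + 1) ∈ convexHull ℝ S := by
  set c := Real.cos (Real.pi / n)
  have hc : 0 < 1 - c := hε0.trans hε
  set t := ε / (1 - c)
  have ht : t * (1 - c) = ε := div_mul_cancel₀ _ hc.ne'
  have ht0 : 0 ≤ t := by positivity
  have ht1 : 0 ≤ 1 - t := sub_nonneg.mpr ((div_le_one hc).mpr hε.le)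
  have hmid : (1 / 2 : ℝ) • gPt n j + (1 / 2 : ℝ) • gPt n (j + 2) ∈ convexHull ℝ S :=
    convex_convexHull ℝ S (subset_convexHull ℝ S h0) (subset_convexHull ℝ S h2)
      (by norm_num) (by norm_num) (by norm_num)
  have hmem := convex_convexHull ℝ S (subset_convexHull ℝ S h1) hmid ht1 ht0 (by ring)
  convert hmem using 1
  rw [← smul_add, gPt_add_gPt hn, smul_smul, smul_smul, ← add_smul,
    show 1 - t + t * (1 / 2) * (2 * Real.cos (Real.pi / n)) = 1 - ε by linear_combination -ht]
  simp [rPt, gPt]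

/-- For every `n ≥ 2` and admissible `ε`, the extremal points of the moon
`𝓛ₙ` are exactly its green points. -/
theorem statement13 (n : ℕ) (hn : 2 ≤ n) (ε : ℝ)
    (hε0 : 0 < ε) (hε1 : ε < 1 - Real.cos (Real.pi / (2 * n))) :
    exPts (moonPts n ε) = moonGreens n := by
  have hn0 : (0 : ℝ) < n := by exact_mod_cast (by omega : 0 < n)
  have hn2 : (2 : ℝ) ≤ n := by exact_mod_cast hn
  have hpi := Real.pi_pos
  have hhalf : Real.pi / (2 * n) ≤ Real.pi / n := by gcongr; linarith
  have hle : Real.pi / n ≤ Real.pi / 2 := by gcongr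
  have hcos0 : 0 ≤ Real.cos (Real.pi / (2 * n)) :=
    Real.cos_nonneg_of_neg_pi_div_two_le_of_le
      ((by linarith : -(Real.pi / 2) ≤ 0).trans (by positivity)) (hhalf.trans hle)
  have hcos : Real.cos (Real.pi / n) ≤ Real.cos (Real.pi / (2 * n)) :=
    Real.cos_le_cos_of_nonneg_of_le_pi (by positivity) (by linarith) hhalf
  have hsq : (1 - ε) ^ 2 < 1 := by nlinarith
  ext c
  simp only [exPts, Finset.mem_filter]
  constructor
  · rintro ⟨hc, hex⟩
    refine (Finset.mem_union.mp hc).resolve_right fun hred => hex ?_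
    obtain ⟨j, hj, rfl⟩ := Finset.mem_image.mp hred
    obtain ⟨hj1, hjn⟩ := Finset.mem_Icc.mp hj
    obtain ⟨i, rfl⟩ := Nat.exists_eq_add_of_le' hj1
    have hmem (k : ℕ) (hk : k ≤ n) :
        gPt n k ∈ (((moonPts n ε).erase (rPt n ε (i + 1)) : Finset (ℝ × ℝ)) : Set (ℝ × ℝ)) := by
      refine Finset.mem_coe.mpr (Finset.mem_erase.mpr ⟨fun h => ?_, Finset.mem_union_left _
        (Finset.mem_image_of_mem _ (Finset.mem_range.mpr (by omega)))⟩)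
      have h1 := gPt_norm_sq n k
      rw [h, rPt_norm_sq] at h1
      exact hsq.ne h1
    exact rPt_mem_convexHull (by omega) hε0 (by linarith) i (hmem _ (by omega))
      (hmem _ (by omega)) (hmem _ (by omega))
  · intro hc
    refine ⟨Finset.mem_union_left _ hc, ?_⟩
    obtain ⟨j, -, rfl⟩ := Finset.mem_image.mp hc
    refine notMem_convexHull_of_unit_circle (gPt_norm_sq n j) (fun q hq => ?_) (by simp)
    rcases Finset.mem_union.mp (Finset.mem_of_mem_erase (Finset.mem_coe.mp hq)) with h | h
    · obtain ⟨k, -, rfl⟩ := Finset.mem_image.mp h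
      exact (gPt_norm_sq n k).le
    · obtain ⟨k, -, rfl⟩ := Finset.mem_image.mp h
      exact (rPt_norm_sq n ε k).trans_le hsq.le

end
end

section
/- For every integer n ≥ 3 and every admissible ε such that the points of the moon 𝓛ₙ are in general position (no three collinear): (a) for every green point g of 𝓛ₙ, exactly one red point of 𝓛ₙ belongs to Ex(𝓛ₙ \ {g}); and (b) if r denotes that red point, then the set 𝓛ₙ \ {g, r} is order-equivalent to the moon 𝓛ₙ₋₁ (constructed with some admissible ε′). -/
open scoped Classical

noncomputable section

/-- Two weighted finite point sets (cakes) are order-equivalent: there is a bijection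
preserving weights and multiplying all orientations by a fixed sign `σ ∈ {−1, +1}`. -/
def OrderEquivCakes (P Q : Finset (ℝ × ℝ)) (wP wQ : ℝ × ℝ → ℕ) : Prop :=
  ∃ π : ℝ × ℝ → ℝ × ℝ,
    Set.BijOn π (↑P : Set (ℝ × ℝ)) (↑Q : Set (ℝ × ℝ)) ∧
    (∀ c ∈ P, wQ (π c) = wP c) ∧
    ∃ σ : ℝ, (σ = 1 ∨ σ = -1) ∧
      ∀ p ∈ P, ∀ q ∈ P, ∀ r ∈ P, p ≠ q → p ≠ r → q ≠ r →
        orient (π p) (π q) (π r) = σ * orient p q r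

/-- The radius of the points of a moon: `true` stands for red, `false` for green. -/
def moonRadius (ε : ℝ) (c : Bool) : ℝ := if c then 1 - ε else 1

/-- The point of the moon with a given index and colour. -/
def moonPt (n : ℕ) (ε : ℝ) (x : ℕ × Bool) : ℝ × ℝ :=
  (moonRadius ε x.2 * Real.cos (x.1 * Real.pi / n),
    -(moonRadius ε x.2 * Real.sin (x.1 * Real.pi / n)))

/-- The pairs of index and colour that occur in the moon with `n` rays. -/
def moonLabels (n : ℕ) : Set (ℕ × Bool) := {x | x.1 ≤ n ∧ (x.2 = true → 0 < x.1 ∧ x.1 < n)}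

/-- The admissible parameters of the moon with `n` rays. -/
def MoonAdmissible (n : ℕ) (ε : ℝ) : Prop := 0 < ε ∧ ε < 1 - Real.cos (Real.pi / (2 * n))

theorem gPt_eq_moonPt (n : ℕ) (ε : ℝ) (i : ℕ) : gPt n i = moonPt n ε (i, false) := by
  simp [gPt, moonPt, moonRadius]

theorem rPt_eq_moonPt (n : ℕ) (ε : ℝ) (i : ℕ) : rPt n ε i = moonPt n ε (i, true) := by
  simp [rPt, moonPt, moonRadius]

theorem orientDet_swap_left (p q r : ℝ × ℝ) : orientDet q p r = -orientDet p q r := by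
  simp only [orientDet]; ring

theorem orientDet_swap_right (p q r : ℝ × ℝ) : orientDet p r q = -orientDet p q r := by
  simp only [orientDet]; ring

theorem orientDet_rotate (p q r : ℝ × ℝ) : orientDet q r p = orientDet p q r := by
  simp only [orientDet]; ring

theorem orientDet_moonPt (n : ℕ) (ε : ℝ) (x y z : ℕ × Bool) :
    orientDet (moonPt n ε x) (moonPt n ε y) (moonPt n ε z) =
      moonRadius ε x.2 * moonRadius ε z.2 *
          Real.sin (z.1 * Real.pi / n - x.1 * Real.pi / n) -
        moonRadius ε x.2 * moonRadius ε y.2 *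
          Real.sin (y.1 * Real.pi / n - x.1 * Real.pi / n) -
        moonRadius ε y.2 * moonRadius ε z.2 *
          Real.sin (z.1 * Real.pi / n - y.1 * Real.pi / n) := by
  simp only [orientDet, moonPt, Real.sin_sub]; ring

/-- The addition inequality behind the convexity of moons. -/
theorem sin_add_lt_mul_sin_add_sin {ρ t u v : ℝ} (ht : 0 < t) (hρ : Real.cos t < ρ)
    (hu : t ≤ u) (hv : t ≤ v) (huv : u + v ≤ Real.pi / 2) :
    Real.sin (2 * u + 2 * v) < ρ * (Real.sin (2 * u) + Real.sin (2 * v)) := by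
  wlog h : u ≤ v generalizing u v
  · have := this hv hu (by linarith) (by linarith)
    rwa [add_comm (2 * u), add_comm (Real.sin (2 * u))]
  have hpi := Real.pi_pos
  have hsu : 0 < Real.sin u := Real.sin_pos_of_pos_of_lt_pi (by linarith) (by linarith)
  have hsv : 0 < Real.sin v := Real.sin_pos_of_pos_of_lt_pi (by linarith) (by linarith)
  have hcu : Real.cos u ≤ Real.cos t :=
    Real.cos_le_cos_of_nonneg_of_le_pi ht.le (by linarith) hu
  have hcu0 : 0 ≤ Real.cos u := Real.cos_nonneg_of_mem_Icc ⟨by linarith, by linarith⟩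
  have hcv : Real.cos v ≤ Real.cos (v - u) :=
    Real.cos_le_cos_of_nonneg_of_le_pi (by linarith) (by linarith) (by linarith)
  have hcvu : 0 < Real.cos (v - u) := Real.cos_pos_of_mem_Ioo ⟨by linarith, by linarith⟩
  have hs : 0 < Real.sin (u + v) := Real.sin_pos_of_pos_of_lt_pi (by linarith) (by linarith)
  have h1 : Real.sin (2 * u + 2 * v) = 2 * Real.sin (u + v) * Real.cos (u + v) := by
    rw [← Real.sin_two_mul]; ring_nf
  have h2 : Real.sin (2 * u) + Real.sin (2 * v) =
      2 * Real.sin (u + v) * Real.cos (v - u) := by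
    rw [show 2 * u = (u + v) - (v - u) by ring, show 2 * v = (u + v) + (v - u) by ring,
      Real.sin_sub, Real.sin_add (u + v)]
    ring
  have h3 : Real.cos (u + v) < ρ * Real.cos (v - u) := by
    rw [Real.cos_add]
    nlinarith [mul_pos hsu hsv, mul_le_mul_of_nonneg_left hcv hcu0,
      mul_le_mul_of_nonneg_right (hcu.trans hρ.le) hcvu.le]
  rw [h1, h2]
  nlinarith [mul_lt_mul_of_pos_left h3 hs]

theorem index_mul_pi_div (n i : ℕ) :
    (i : ℝ) * Real.pi / n = 2 * (i * (Real.pi / (2 * n))) := by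
  rw [← div_div]; ring

namespace MoonAdmissible

variable {n : ℕ} {ε : ℝ}

theorem cos_lt (h : MoonAdmissible n ε) : Real.cos (Real.pi / (2 * n)) < 1 - ε := by
  linarith [h.2]

theorem lt_one (hn : 0 < n) (h : MoonAdmissible n ε) : ε < 1 := by
  have hn' : (1 : ℝ) ≤ n := by exact_mod_cast hn
  have : 0 ≤ Real.cos (Real.pi / (2 * n)) := by
    apply Real.cos_nonneg_of_mem_Icc
    have := Real.pi_pos
    constructor
    · exact (by linarith : -(Real.pi / 2) ≤ 0).trans (by positivity)
    · gcongr
      linarith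
  linarith [h.2]

theorem radius_le_one (h : MoonAdmissible n ε) (c : Bool) : moonRadius ε c ≤ 1 := by
  cases c <;> simp [moonRadius, h.1.le]

theorem le_radius (h : MoonAdmissible n ε) (c : Bool) : 1 - ε ≤ moonRadius ε c := by
  cases c <;> simp [moonRadius, h.1.le]

theorem radius_pos (hn : 0 < n) (h : MoonAdmissible n ε) (c : Bool) : 0 < moonRadius ε c := by
  linarith [h.le_radius c, h.lt_one hn]

theorem mono (hn : 3 ≤ n) (h : MoonAdmissible n ε) : MoonAdmissible (n - 1) ε := by
  refine ⟨h.1, h.2.trans_le ?_⟩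
  have hn' : (3 : ℝ) ≤ n := by exact_mod_cast hn
  have h1 : ((n - 1 : ℕ) : ℝ) = n - 1 := by
    rw [Nat.cast_sub (by omega)]; simp
  have hpi := Real.pi_pos
  rw [h1]
  gcongr 1 - ?_
  apply Real.cos_le_cos_of_nonneg_of_le_pi
  · positivity
  · rw [div_le_iff₀ (by linarith)]
    nlinarith
  · gcongr
    all_goals linarith

/-- Points of increasing index are in convex position. -/
theorem orientDet_neg (h : MoonAdmissible n ε) {x y z : ℕ × Bool} (hxy : x.1 < y.1)
    (hyz : y.1 < z.1) (hz : z.1 ≤ n) :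
    orientDet (moonPt n ε x) (moonPt n ε y) (moonPt n ε z) < 0 := by
  have hn : 0 < n := by omega
  have hn' : (0 : ℝ) < n := by exact_mod_cast hn
  have hxy' : (x.1 : ℝ) + 1 ≤ y.1 := by exact_mod_cast hxy
  have hyz' : (y.1 : ℝ) + 1 ≤ z.1 := by exact_mod_cast hyz
  have hz' : (z.1 : ℝ) ≤ n := by exact_mod_cast hz
  have hx' : (0 : ℝ) ≤ x.1 := by positivity
  have hpi := Real.pi_pos
  set t := Real.pi / (2 * n) with ht
  have ht0 : 0 < t := by positivity
  have hnt : n * t = Real.pi / 2 := by rw [ht]; field_simp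
  have hu : t ≤ (y.1 - x.1) * t := by nlinarith
  have hv : t ≤ (z.1 - y.1) * t := by nlinarith
  have huv : (y.1 - x.1) * t + (z.1 - y.1) * t ≤ Real.pi / 2 := by
    rw [← hnt]; nlinarith
  have key := sin_add_lt_mul_sin_add_sin ht0 h.cos_lt hu hv huv
  have hsu : 0 ≤ Real.sin (2 * ((y.1 - x.1) * t)) :=
    Real.sin_nonneg_of_nonneg_of_le_pi (by linarith) (by linarith)
  have hsv : 0 ≤ Real.sin (2 * ((z.1 - y.1) * t)) :=
    Real.sin_nonneg_of_nonneg_of_le_pi (by linarith) (by linarith)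
  rw [orientDet_moonPt, index_mul_pi_div, index_mul_pi_div, index_mul_pi_div, ← ht,
    show 2 * (z.1 * t) - 2 * (x.1 * t) = 2 * ((y.1 - x.1) * t) + 2 * ((z.1 - y.1) * t) by ring,
    show 2 * (y.1 * t) - 2 * (x.1 * t) = 2 * ((y.1 - x.1) * t) by ring,
    show 2 * (z.1 * t) - 2 * (y.1 * t) = 2 * ((z.1 - y.1) * t) by ring]
  generalize Real.sin (2 * ((y.1 - x.1) * t)) = su at *
  generalize Real.sin (2 * ((z.1 - y.1) * t)) = sv at *
  have hx0 := h.radius_pos hn x.2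
  have hy0 := h.radius_pos hn y.2
  have hz0 := h.radius_pos hn z.2
  have hxz := mul_pos hx0 hz0
  have h1 := mul_lt_mul_of_pos_left key hxz
  have h2 : moonRadius ε x.2 * moonRadius ε z.2 * ((1 - ε) * (su + sv)) ≤
      moonRadius ε x.2 * moonRadius ε z.2 * (moonRadius ε y.2 * (su + sv)) := by
    gcongr
    exact h.le_radius y.2
  have h3 : moonRadius ε x.2 * moonRadius ε y.2 * su * moonRadius ε z.2 ≤
      moonRadius ε x.2 * moonRadius ε y.2 * su :=
    mul_le_of_le_one_right (by positivity) (h.radius_le_one _)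
  have h4 : moonRadius ε y.2 * moonRadius ε z.2 * sv * moonRadius ε x.2 ≤
      moonRadius ε y.2 * moonRadius ε z.2 * sv :=
    mul_le_of_le_one_right (by positivity) (h.radius_le_one _)
  linarith

theorem orientDet_red_green_neg (h : MoonAdmissible n ε) {i : ℕ} {z : ℕ × Bool} (hi : 0 < i)
    (hz : z.1 ≤ n) (hiz : i < z.1) :
    orientDet (moonPt n ε (i, true)) (moonPt n ε (i, false)) (moonPt n ε z) < 0 := by
  have hn : 0 < n := by omega
  have hn' : (0 : ℝ) < n := by exact_mod_cast hn
  have hiz' : (i : ℝ) < z.1 := by exact_mod_cast hiz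
  have hi' : (0 : ℝ) < i := by exact_mod_cast hi
  have hz' : (z.1 : ℝ) ≤ n := by exact_mod_cast hz
  have hs : 0 < Real.sin (z.1 * Real.pi / n - i * Real.pi / n) := by
    rw [← sub_div, ← sub_mul]
    apply Real.sin_pos_of_pos_of_lt_pi
    · exact div_pos (mul_pos (by linarith) Real.pi_pos) hn'
    · rw [div_lt_iff₀ hn', mul_comm]
      exact mul_lt_mul_of_pos_left (by linarith) Real.pi_pos
  have := mul_pos (mul_pos h.1 (h.radius_pos hn z.2)) hs
  rw [orientDet_moonPt]
  simp only [sub_self, Real.sin_zero, mul_zero, moonRadius, if_true] at this ⊢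
  simp only [Bool.false_eq_true, if_false]
  linarith

theorem orientDet_green_red_neg (h : MoonAdmissible n ε) {i : ℕ} {z : ℕ × Bool}
    (hi : i < n) (hz : z.1 < i) :
    orientDet (moonPt n ε (i, false)) (moonPt n ε (i, true)) (moonPt n ε z) < 0 := by
  have hn : 0 < n := by omega
  have hn' : (0 : ℝ) < n := by exact_mod_cast hn
  have hiz' : (z.1 : ℝ) < i := by exact_mod_cast hz
  have hi' : (i : ℝ) < n := by exact_mod_cast hi
  have hz' : (0 : ℝ) ≤ z.1 := by positivity
  have hs : 0 < Real.sin (i * Real.pi / n - z.1 * Real.pi / n) := by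
    rw [← sub_div, ← sub_mul]
    apply Real.sin_pos_of_pos_of_lt_pi
    · exact div_pos (mul_pos (by linarith) Real.pi_pos) hn'
    · rw [div_lt_iff₀ hn', mul_comm]
      exact mul_lt_mul_of_pos_left (by linarith) Real.pi_pos
  have := mul_pos (mul_pos h.1 (h.radius_pos hn z.2)) hs
  rw [orientDet_moonPt]
  rw [← neg_sub, Real.sin_neg] at this
  simp only [sub_self, Real.sin_zero, mul_zero, moonRadius, if_true] at this ⊢
  simp only [Bool.false_eq_true, if_false]
  linarith

theorem injOn_moonPt (hn : 0 < n) (h : MoonAdmissible n ε) :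
    Set.InjOn (moonPt n ε) (moonLabels n) := by
  rintro ⟨i, c⟩ hx ⟨k, d⟩ hy hxy
  have hn' : (0 : ℝ) < n := by exact_mod_cast hn
  have hc := h.radius_pos hn c
  have hd := h.radius_pos hn d
  simp only [moonPt, Prod.mk.injEq, neg_inj] at hxy
  have hr : moonRadius ε c = moonRadius ε d := by
    have h1 : moonRadius ε c ^ 2 = moonRadius ε d ^ 2 := by
      have h2 := Real.sin_sq_add_cos_sq (i * Real.pi / n)
      have h3 := Real.sin_sq_add_cos_sq (k * Real.pi / n)
      calc _ = (moonRadius ε c * Real.cos (i * Real.pi / n)) ^ 2 +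
            (moonRadius ε c * Real.sin (i * Real.pi / n)) ^ 2 := by
              linear_combination -(moonRadius ε c ^ 2) * h2
        _ = (moonRadius ε d * Real.cos (k * Real.pi / n)) ^ 2 +
            (moonRadius ε d * Real.sin (k * Real.pi / n)) ^ 2 := by rw [hxy.1, hxy.2]
        _ = _ := by linear_combination moonRadius ε d ^ 2 * h3
    exact (pow_left_inj₀ hc.le hd.le two_ne_zero).1 h1
  have hcd : c = d := by
    have := h.1
    cases c <;> cases d <;> simp [moonRadius] at hr ⊢ <;> linarith
  subst hcd
  have hcos := mul_left_cancel₀ hc.ne' hxy.1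
  have hmem : ∀ m : ℕ, m ≤ n → (m : ℝ) * Real.pi / n ∈ Set.Icc 0 Real.pi := by
    intro m hm
    have hm' : (m : ℝ) ≤ n := by exact_mod_cast hm
    have hpi := Real.pi_pos
    refine ⟨by positivity, ?_⟩
    rw [div_le_iff₀ hn', mul_comm]
    gcongr
  have hang := Real.injOn_cos (hmem i hx.1) (hmem k hy.1) hcos
  field_simp at hang
  simpa using hang

end MoonAdmissible

theorem mem_moonGreens {n : ℕ} (ε : ℝ) {p : ℝ × ℝ} :
    p ∈ moonGreens n ↔ ∃ i ≤ n, p = moonPt n ε (i, false) := by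
  simp only [moonGreens, Finset.mem_image, Finset.mem_range, gPt_eq_moonPt n ε, eq_comm (a := p),
    Nat.lt_succ_iff]

theorem mem_moonReds {n : ℕ} {ε : ℝ} {p : ℝ × ℝ} :
    p ∈ moonReds n ε ↔ ∃ i, (0 < i ∧ i < n) ∧ p = moonPt n ε (i, true) := by
  simp only [moonReds, Finset.mem_image, Finset.mem_Icc, rPt_eq_moonPt, eq_comm (a := p)]
  refine exists_congr fun i => and_congr_left fun _ => by omega

theorem coe_moonPts (n : ℕ) (ε : ℝ) :
    (moonPts n ε : Set (ℝ × ℝ)) = moonPt n ε '' moonLabels n := by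
  ext p
  simp only [moonPts, Finset.coe_union, Set.mem_union, Finset.mem_coe, mem_moonGreens ε,
    mem_moonReds, Set.mem_image, moonLabels, Set.mem_ofPred_eq]
  constructor
  · rintro (⟨i, hi, rfl⟩ | ⟨i, hi, rfl⟩)
    · exact ⟨(i, false), by simpa using hi, rfl⟩
    · exact ⟨(i, true), ⟨hi.2.le, fun _ => hi⟩, rfl⟩
  · rintro ⟨⟨i, _ | _⟩, hi, rfl⟩
    · exact Or.inl ⟨i, hi.1, rfl⟩
    · exact Or.inr ⟨i, hi.2 rfl, rfl⟩

theorem moonW_moonPt {n : ℕ} {ε : ℝ} (hn : 0 < n) (h : MoonAdmissible n ε) {x : ℕ × Bool}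
    (hx : x ∈ moonLabels n) : moonW n ε (moonPt n ε x) = if x.2 then 1 else 0 := by
  have : moonPt n ε x ∈ moonReds n ε ↔ x.2 = true := by
    rw [mem_moonReds]
    constructor
    · rintro ⟨i, hi, hxi⟩
      rw [h.injOn_moonPt hn hx ⟨hi.2.le, fun _ => hi⟩ hxi]
    · intro hc
      exact ⟨x.1, hx.2 hc, by rw [← hc]⟩
  simp only [moonW, this]

theorem orientDet_mul_orientDet_pos_of_ray {n m : ℕ} {ε δ : ℝ} (hn : MoonAdmissible n ε)
    (hm : MoonAdmissible m δ) {i k : ℕ} {c d : Bool} {x y : ℕ × Bool} (hcd : c ≠ d)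
    (hi : 0 < i ∧ i < n) (hk : 0 < k ∧ k < m) (hx : x.1 ≤ n) (hy : y.1 ≤ m)
    (h : x.1 < i ∧ y.1 < k ∨ i < x.1 ∧ k < y.1) :
    0 < orientDet (moonPt n ε (i, c)) (moonPt n ε (i, d)) (moonPt n ε x) *
      orientDet (moonPt m δ (k, c)) (moonPt m δ (k, d)) (moonPt m δ y) := by
  have key : 0 < orientDet (moonPt n ε (i, true)) (moonPt n ε (i, false)) (moonPt n ε x) *
      orientDet (moonPt m δ (k, true)) (moonPt m δ (k, false)) (moonPt m δ y) := by
    rcases h with h | h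
    · rw [orientDet_swap_left (moonPt n ε (i, false)), orientDet_swap_left (moonPt m δ (k, false)),
        neg_mul_neg]
      exact mul_pos_of_neg_of_neg (hn.orientDet_green_red_neg hi.2 h.1)
        (hm.orientDet_green_red_neg hk.2 h.2)
    · exact mul_pos_of_neg_of_neg (hn.orientDet_red_green_neg hi.1 hx h.1)
        (hm.orientDet_red_green_neg hk.1 hy h.2)
  cases c <;> cases d
  · exact absurd rfl hcd
  · rwa [orientDet_swap_left (moonPt n ε (i, true)), orientDet_swap_left (moonPt m δ (k, true)),
      neg_mul_neg]
  · exact key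
  · exact absurd rfl hcd

theorem red_mem_moonLabels {n i : ℕ} {c d : Bool} (hcd : c ≠ d) (hc : (i, c) ∈ moonLabels n)
    (hd : (i, d) ∈ moonLabels n) : 0 < i ∧ i < n := by
  cases c
  · cases d
    · exact absurd rfl hcd
    · exact hd.2 rfl
  · exact hc.2 rfl

/-- The orientations of two moons agree on triples whose indices are in the same relative order. -/
theorem orientDet_mul_orientDet_pos {n m : ℕ} {ε δ : ℝ} (hn : MoonAdmissible n ε)
    (hm : MoonAdmissible m δ) {f : ℕ × Bool → ℕ × Bool} {S : Set (ℕ × Bool)}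
    (hS : S ⊆ moonLabels n) (hf : Set.MapsTo f S (moonLabels m))
    (hlt : ∀ x ∈ S, ∀ y ∈ S, x.1 < y.1 → (f x).1 < (f y).1)
    (heq : ∀ x ∈ S, ∀ y ∈ S, x.1 = y.1 → (f x).1 = (f y).1)
    (hcol : ∀ x, (f x).2 = x.2) {x y z : ℕ × Bool} (hx : x ∈ S) (hy : y ∈ S) (hz : z ∈ S)
    (hxy : x ≠ y) (hxz : x ≠ z) (hyz : y ≠ z) :
    0 < orientDet (moonPt n ε x) (moonPt n ε y) (moonPt n ε z) *
      orientDet (moonPt m δ (f x)) (moonPt m δ (f y)) (moonPt m δ (f z)) := by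
  have ray : ∀ x ∈ S, ∀ y ∈ S, ∀ z ∈ S, x ≠ y → x.1 = y.1 → x.1 ≠ z.1 →
      0 < orientDet (moonPt n ε x) (moonPt n ε y) (moonPt n ε z) *
      orientDet (moonPt m δ (f x)) (moonPt m δ (f y)) (moonPt m δ (f z)) := by
    rintro ⟨i, c⟩ hx ⟨k, d⟩ hy z hz hxy rfl hne
    have hcd : c ≠ d := fun h => hxy (by rw [h])
    have hx' : f (i, c) = ((f (i, c)).1, c) := Prod.ext rfl (hcol _)
    have hy' : f (i, d) = ((f (i, c)).1, d) := Prod.ext (heq _ hy _ hx rfl) (hcol _)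
    have hfx := hf hx
    have hfy := hf hy
    rw [hx'] at hfx
    rw [hy'] at hfy
    rw [hx', hy']
    refine orientDet_mul_orientDet_pos_of_ray hn hm hcd (red_mem_moonLabels hcd (hS hx) (hS hy))
      (red_mem_moonLabels hcd hfx hfy) (hS hz).1 (hf hz).1 ?_
    rcases hne.lt_or_gt with h | h
    · exact Or.inr ⟨h, hlt _ hx _ hz h⟩
    · exact Or.inl ⟨h, hlt _ hz _ hx h⟩
  have ne13 : ∀ {x y z : ℕ × Bool}, x ≠ y → x ≠ z → y ≠ z → x.1 ≤ y.1 → y.1 ≤ z.1 →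
      x.1 < z.1 := by
    rintro ⟨i, a⟩ ⟨k, b⟩ ⟨l, c⟩ h1 h2 h3 h4 h5
    dsimp only at *
    by_contra h6
    obtain rfl : i = k := by omega
    obtain rfl : i = l := by omega
    cases a <;> cases b <;> cases c <;>
      first | exact h1 rfl | exact h2 rfl | exact h3 rfl
  have perm : ∀ {x y z : ℕ × Bool}, 0 < orientDet (moonPt n ε x) (moonPt n ε y) (moonPt n ε z) *
      orientDet (moonPt m δ (f x)) (moonPt m δ (f y)) (moonPt m δ (f z)) →
      0 < orientDet (moonPt n ε x) (moonPt n ε z) (moonPt n ε y) *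
      orientDet (moonPt m δ (f x)) (moonPt m δ (f z)) (moonPt m δ (f y)) := by
    intro x y z h
    rwa [orientDet_swap_right, orientDet_swap_right (moonPt m δ (f x)), neg_mul_neg]
  have rot : ∀ {x y z : ℕ × Bool}, 0 < orientDet (moonPt n ε x) (moonPt n ε y) (moonPt n ε z) *
      orientDet (moonPt m δ (f x)) (moonPt m δ (f y)) (moonPt m δ (f z)) →
      0 < orientDet (moonPt n ε y) (moonPt n ε z) (moonPt n ε x) *
      orientDet (moonPt m δ (f y)) (moonPt m δ (f z)) (moonPt m δ (f x)) := by
    intro x y z h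
    rwa [orientDet_rotate (moonPt n ε x), orientDet_rotate (moonPt m δ (f x))]
  have sorted : ∀ x ∈ S, ∀ y ∈ S, ∀ z ∈ S, x ≠ y → x ≠ z → y ≠ z → x.1 ≤ y.1 → y.1 ≤ z.1 →
      0 < orientDet (moonPt n ε x) (moonPt n ε y) (moonPt n ε z) *
      orientDet (moonPt m δ (f x)) (moonPt m δ (f y)) (moonPt m δ (f z)) := by
    intro x hx y hy z hz hxy hxz hyz h1 h2
    have h3 := ne13 hxy hxz hyz h1 h2
    rcases h1.lt_or_eq with h1 | h1
    · rcases h2.lt_or_eq with h2 | h2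
      · exact mul_pos_of_neg_of_neg (hn.orientDet_neg h1 h2 (hS hz).1)
          (hm.orientDet_neg (hlt _ hx _ hy h1) (hlt _ hy _ hz h2) (hf hz).1)
      · exact rot (rot (ray y hy z hz x hx hyz h2 (by omega)))
    · exact ray x hx y hy z hz hxy h1 (by omega)
  rcases le_total x.1 y.1 with h1 | h1 <;> rcases le_total y.1 z.1 with h2 | h2
  · exact sorted x hx y hy z hz hxy hxz hyz h1 h2
  · rcases le_total x.1 z.1 with h3 | h3
    · exact perm (sorted x hx z hz y hy hxz hxy hyz.symm h3 h2)
    · exact rot (sorted z hz x hx y hy hxz.symm hyz.symm hxy h3 h1)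
  · rcases le_total x.1 z.1 with h3 | h3
    · exact rot (rot (perm (sorted y hy x hx z hz hxy.symm hyz hxz h1 h3)))
    · exact rot (rot (sorted y hy z hz x hx hyz hxy.symm hxz.symm h2 h3))
  · exact perm (rot (rot (sorted z hz y hy x hx hyz.symm hxz.symm hxy.symm h2 h1)))

theorem mem_convexHull_of_orientDet_neg {S : Set (ℝ × ℝ)} {a b c p : ℝ × ℝ} (ha : a ∈ S)
    (hb : b ∈ S) (hc : c ∈ S) (h1 : orientDet p b c < 0) (h2 : orientDet a p c < 0)
    (h3 : orientDet a b p < 0) : p ∈ convexHull ℝ S := by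
  have hsum : orientDet a b c = orientDet p b c + orientDet a p c + orientDet a b p := by
    simp only [orientDet]; ring
  have habc : orientDet a b c < 0 := by linarith
  obtain ⟨u, hu⟩ : ∃ u, u * orientDet a b c = orientDet p b c :=
    ⟨_, div_mul_cancel₀ _ habc.ne⟩
  obtain ⟨v, hv⟩ : ∃ v, v * orientDet a b c = orientDet a p c :=
    ⟨_, div_mul_cancel₀ _ habc.ne⟩
  obtain ⟨w, hw⟩ : ∃ w, w * orientDet a b c = orientDet a b p :=
    ⟨_, div_mul_cancel₀ _ habc.ne⟩
  have hu0 : 0 ≤ u := by nlinarith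
  have hv0 : 0 ≤ v := by nlinarith
  have hw0 : 0 ≤ w := by nlinarith
  have huvw : u + v + w = 1 := mul_right_cancel₀ habc.ne (by linarith)
  have hp : u • a + v • b + w • c = p := by
    ext
    · simp only [Prod.fst_add, Prod.smul_fst, smul_eq_mul]
      apply mul_right_cancel₀ habc.ne
      linear_combination (norm := skip) a.1 * hu + b.1 * hv + c.1 * hw
      simp only [orientDet]; ring
    · simp only [Prod.snd_add, Prod.smul_snd, smul_eq_mul]
      apply mul_right_cancel₀ habc.ne
      linear_combination (norm := skip) a.2 * hu + b.2 * hv + c.2 * hw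
      simp only [orientDet]; ring
  have hmem := (convex_convexHull ℝ S).sum_mem (t := Finset.univ)
    (w := ![u, v, w]) (z := ![a, b, c]) ?_ ?_ ?_
  · simpa [Fin.sum_univ_three, hp] using hmem
  · intro i _
    fin_cases i
    exacts [hu0, hv0, hw0]
  · simpa [Fin.sum_univ_three] using huvw
  · intro i _
    fin_cases i
    exacts [subset_convexHull ℝ S ha, subset_convexHull ℝ S hb, subset_convexHull ℝ S hc]

theorem notMem_convexHull_of_orientDet {S : Set (ℝ × ℝ)} {a c p : ℝ × ℝ} {s : ℝ}
    (hS : ∀ q ∈ S, 0 ≤ s * orientDet a q c) (hp : s * orientDet a p c < 0) :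
    p ∉ convexHull ℝ S := by
  have hconv : Convex ℝ {q : ℝ × ℝ | 0 ≤ s * orientDet a q c} := by
    intro q hq r hr α β hα hβ hαβ
    simp only [Set.mem_ofPred_eq] at hq hr ⊢
    have : s * orientDet a (α • q + β • r) c =
        α * (s * orientDet a q c) + β * (s * orientDet a r c) := by
      obtain rfl : β = 1 - α := by linarith
      simp only [orientDet, Prod.fst_add, Prod.snd_add, Prod.smul_fst, Prod.smul_snd,
        smul_eq_mul]
      ring
    rw [this]
    positivity
  intro h
  exact absurd (convexHull_min hS hconv h) (not_le.2 hp)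

/-- The index of the red point exposed by removing the green point of index `j`. -/
def exposedIndex (n j : ℕ) : ℕ := max 1 (min j (n - 1))

/-- The labels left after removing the green point of index `j` and the red point of index `k`. -/
def remainingLabels (n j k : ℕ) : Set (ℕ × Bool) :=
  {x ∈ moonLabels n | x ≠ (j, false) ∧ x ≠ (k, true)}

/-- Close the gap in the indices left by removing the index `j`. -/
def closeGap (j : ℕ) (x : ℕ × Bool) : ℕ × Bool := (if x.1 < j then x.1 else x.1 - 1, x.2)

theorem green_mem_remainingLabels {n j k i : ℕ} (hi : i ≤ n) (hij : i ≠ j) :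
    (i, false) ∈ remainingLabels n j k :=
  ⟨⟨hi, by simp⟩, by simpa using hij, by simp⟩

namespace MoonAdmissible

variable {n : ℕ} {ε : ℝ}

theorem coe_erase_erase (hn : 0 < n) (h : MoonAdmissible n ε) {j k : ℕ} (hj : j ≤ n)
    (hk : 0 < k ∧ k < n) :
    ((((moonPts n ε).erase (moonPt n ε (j, false))).erase (moonPt n ε (k, true)) :
      Finset (ℝ × ℝ)) : Set (ℝ × ℝ)) = moonPt n ε '' remainingLabels n j k := by
  have hinj := h.injOn_moonPt hn
  rw [Finset.coe_erase, Finset.coe_erase, coe_moonPts]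
  ext p
  constructor
  · rintro ⟨⟨⟨x, hx, rfl⟩, h1⟩, h2⟩
    exact ⟨x, ⟨hx, fun h => h1 (by rw [h]; rfl), fun h => h2 (by rw [h]; rfl)⟩, rfl⟩
  · rintro ⟨x, ⟨hx, h1, h2⟩, rfl⟩
    exact ⟨⟨⟨x, hx, rfl⟩, fun h => h1 (hinj hx ⟨hj, by simp⟩ h)⟩,
      fun h => h2 (hinj hx ⟨hk.2.le, fun _ => hk⟩ h)⟩

theorem red_mem_exPts_iff (hn : 0 < n) (h : MoonAdmissible n ε) {j k : ℕ} (hj : j ≤ n)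
    (hk : 0 < k ∧ k < n) :
    moonPt n ε (k, true) ∈ exPts ((moonPts n ε).erase (moonPt n ε (j, false))) ↔
      moonPt n ε (k, true) ∉ convexHull ℝ (moonPt n ε '' remainingLabels n j k) := by
  have hkL : (k, true) ∈ moonLabels n := ⟨hk.2.le, fun _ => hk⟩
  have hmem : moonPt n ε (k, true) ∈ (moonPts n ε).erase (moonPt n ε (j, false)) := by
    rw [Finset.mem_erase]
    constructor
    · intro heq
      have := h.injOn_moonPt hn hkL ⟨hj, by simp⟩ heq
      simp at this
    · rw [← Finset.mem_coe, coe_moonPts]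
      exact ⟨_, hkL, rfl⟩
  rw [exPts, Finset.mem_filter, and_iff_right hmem, h.coe_erase_erase hn hj hk]

theorem red_mem_convexHull (h : MoonAdmissible n ε) {j k : ℕ}
    (hk : 0 < k ∧ k < n) (hjk : k ≠ exposedIndex n j) :
    moonPt n ε (k, true) ∈ convexHull ℝ (moonPt n ε '' remainingLabels n j k) := by
  obtain ⟨l, u, hlj, huj, hlk, hku, hun⟩ :
      ∃ l u, l ≠ j ∧ u ≠ j ∧ l < k ∧ k < u ∧ u ≤ n := by
    unfold exposedIndex at hjk
    refine ⟨if j = 0 then 1 else 0, if j = n then n - 1 else n, ?_, ?_, ?_, ?_, ?_⟩ <;>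
      split_ifs <;> omega
  have hkj : k ≠ j := by unfold exposedIndex at hjk; omega
  have hmem : ∀ i, i ≤ n → i ≠ j →
      moonPt n ε (i, false) ∈ moonPt n ε '' remainingLabels n j k := fun i hi hij =>
    ⟨_, green_mem_remainingLabels hi hij, rfl⟩
  refine mem_convexHull_of_orientDet_neg (hmem l (by omega) hlj) (hmem k hk.2.le hkj)
    (hmem u hun huj) (h.orientDet_red_green_neg hk.1 hun hku)
    (h.orientDet_neg hlk hku hun) ?_
  rw [← orientDet_rotate]
  exact h.orientDet_green_red_neg hk.2 hlk

theorem exposed_notMem_convexHull (hn : 3 ≤ n) (h : MoonAdmissible n ε) {j : ℕ} (hj : j ≤ n) :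
    moonPt n ε (exposedIndex n j, true) ∉
      convexHull ℝ (moonPt n ε '' remainingLabels n j (exposedIndex n j)) := by
  have hzero : ∀ p q : ℝ × ℝ, orientDet p p q = 0 := fun p q => by
    simp only [orientDet]; ring
  have hzero' : ∀ p q : ℝ × ℝ, orientDet p q q = 0 := fun p q => by
    simp only [orientDet]; ring
  obtain rfl | hj0 := Nat.eq_zero_or_pos j
  · have he : exposedIndex n 0 = 1 := by unfold exposedIndex; omega
    rw [he]
    refine notMem_convexHull_of_orientDet (a := moonPt n ε (1, false))
      (c := moonPt n ε (n, false)) (s := -1) ?_ ?_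
    · rintro _ ⟨⟨i, c⟩, ⟨hx, h1, h2⟩, rfl⟩
      have hi1 : 0 < i := by
        cases c
        · exact Nat.pos_of_ne_zero fun hi => h1 (by rw [hi])
        · exact (hx.2 rfl).1
      rcases (Nat.succ_le_of_lt hi1).eq_or_lt with rfl | hi1
      · cases c
        · rw [hzero, mul_zero]
        · exact absurd rfl h2
      rcases hx.1.eq_or_lt with rfl | hin
      · cases c
        · rw [hzero', mul_zero]
        · exact absurd (hx.2 rfl).2 (lt_irrefl _)
      linarith [h.orientDet_neg (x := (1, false)) (y := (i, c)) (z := (n, false)) hi1 hin le_rfl]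
    · rw [orientDet_swap_left]
      linarith [h.orientDet_red_green_neg (i := 1) (z := (n, false)) one_pos le_rfl (by omega)]
  obtain rfl | hjn := hj.eq_or_lt
  · have he : exposedIndex j j = j - 1 := by unfold exposedIndex; omega
    rw [he]
    refine notMem_convexHull_of_orientDet (a := moonPt j ε (0, false))
      (c := moonPt j ε (j - 1, false)) (s := -1) ?_ ?_
    · rintro _ ⟨⟨i, c⟩, ⟨hx, h1, h2⟩, rfl⟩
      have hij : i < j := by
        cases c
        · exact lt_of_le_of_ne hx.1 fun hi => h1 (by rw [hi])
        · exact (hx.2 rfl).2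
      rcases (Nat.le_sub_one_of_lt hij).eq_or_lt with rfl | hij
      · cases c
        · rw [hzero', mul_zero]
        · exact absurd rfl h2
      rcases Nat.eq_zero_or_pos i with rfl | hi0
      · cases c
        · rw [hzero, mul_zero]
        · exact absurd (hx.2 rfl).1 (lt_irrefl _)
      linarith [h.orientDet_neg (x := (0, false)) (y := (i, c)) (z := (j - 1, false)) hi0 hij
        (Nat.sub_le _ _)]
    · rw [orientDet_swap_right, ← orientDet_rotate]
      linarith [h.orientDet_green_red_neg (i := j - 1) (z := (0, false)) (by omega) (by dsimp; omega)]
  · have he : exposedIndex n j = j := by unfold exposedIndex; omega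
    rw [he]
    refine notMem_convexHull_of_orientDet (a := moonPt n ε (j - 1, false))
      (c := moonPt n ε (j + 1, false)) (s := 1) ?_ ?_
    · rintro _ ⟨⟨i, c⟩, ⟨hx, h1, h2⟩, rfl⟩
      have hij : i ≠ j := by
        rintro rfl
        cases c
        exacts [h1 rfl, h2 rfl]
      rw [one_mul]
      rcases lt_trichotomy i (j - 1) with hlt | rfl | hgt
      · rw [orientDet_swap_left]
        linarith [h.orientDet_neg (x := (i, c)) (y := (j - 1, false)) (z := (j + 1, false)) hlt
          (by dsimp; omega) (by dsimp; omega)]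
      · cases c
        · rw [hzero]
        · rw [orientDet_swap_left]
          linarith [h.orientDet_red_green_neg (z := (j + 1, false)) (hx.2 rfl).1
            (by dsimp; omega) (by dsimp; omega)]
      rcases lt_or_eq_of_le (show j + 1 ≤ i by omega) with hlt | rfl
      · rw [orientDet_swap_right]
        linarith [h.orientDet_neg (x := (j - 1, false)) (y := (j + 1, false)) (z := (i, c))
          (by dsimp; omega) hlt hx.1]
      · cases c
        · rw [hzero']
        · rw [orientDet_swap_right, ← orientDet_rotate]
          linarith [h.orientDet_green_red_neg (z := (j - 1, false)) (hx.2 rfl).2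
            (by dsimp; omega)]
    · rw [one_mul]
      exact h.orientDet_neg (by dsimp; omega) (by dsimp; omega) (by dsimp; omega)

end MoonAdmissible

section CloseGap

variable {n j : ℕ}

theorem ne_of_mem_remainingLabels {x : ℕ × Bool}
    (hx : x ∈ remainingLabels n j (exposedIndex n j)) : x.1 ≠ j := by
  obtain ⟨i, c⟩ := x
  obtain ⟨hL, h1, h2⟩ := hx
  rintro rfl
  cases c
  · exact h1 rfl
  · have := hL.2 rfl
    apply h2
    dsimp only at *
    congr 1
    unfold exposedIndex
    omega

theorem mapsTo_closeGap (hj : j ≤ n) :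
    Set.MapsTo (closeGap j) (remainingLabels n j (exposedIndex n j)) (moonLabels (n - 1)) := by
  intro x hx
  have hne := ne_of_mem_remainingLabels hx
  obtain ⟨i, c⟩ := x
  obtain ⟨hL, h1, h2⟩ := hx
  have hLi := hL.1
  dsimp only at hne hLi
  simp only [closeGap, moonLabels, Set.mem_ofPred_eq]
  constructor
  · split_ifs <;> omega
  · rintro rfl
    have := hL.2 rfl
    have h3 : i ≠ exposedIndex n j := fun h => h2 (by rw [h])
    unfold exposedIndex at h3
    dsimp only at *
    constructor <;> split_ifs <;> omega

theorem closeGap_lt {x y : ℕ × Bool} (hx : x.1 ≠ j) (hy : y.1 ≠ j) (hxy : x.1 < y.1) :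
    (closeGap j x).1 < (closeGap j y).1 := by
  simp only [closeGap]
  split_ifs <;> omega

theorem injOn_closeGap : Set.InjOn (closeGap j) {x | x.1 ≠ j} := by
  intro x hx y hy hxy
  have hsnd : (closeGap j x).2 = (closeGap j y).2 := congrArg Prod.snd hxy
  refine Prod.ext ?_ hsnd
  have := congrArg Prod.fst hxy
  by_contra hne
  rcases Nat.lt_or_gt_of_ne hne with h | h
  · exact (closeGap_lt hx hy h).ne this
  · exact (closeGap_lt hy hx h).ne' this

theorem surjOn_closeGap (hn : 3 ≤ n) (hj : j ≤ n) :
    Set.SurjOn (closeGap j) (remainingLabels n j (exposedIndex n j)) (moonLabels (n - 1)) := by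
  rintro ⟨i, c⟩ hx
  have hi := hx.1
  have hc := hx.2
  dsimp only at hi hc
  refine ⟨(if i < j then i else i + 1, c), ⟨⟨?_, ?_⟩, ?_, ?_⟩, ?_⟩
  · dsimp only
    split_ifs <;> omega
  · intro h
    have := hc h
    dsimp only
    split_ifs <;> omega
  · rw [Ne, Prod.mk.injEq]
    split_ifs <;> omega
  · rw [Ne, Prod.mk.injEq]
    rintro ⟨h1, h2⟩
    have := hc h2
    unfold exposedIndex at h1
    split_ifs at h1 <;> omega
  · simp only [closeGap]
    congr 1
    split_ifs <;> omega

end CloseGap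

theorem orderEquivCakes_moonPts {n j : ℕ} {ε : ℝ} (hn : 3 ≤ n) (hj : j ≤ n)
    (h : MoonAdmissible n ε) :
    OrderEquivCakes (((moonPts n ε).erase (moonPt n ε (j, false))).erase
      (moonPt n ε (exposedIndex n j, true))) (moonPts (n - 1) ε) (moonW n ε)
      (moonW (n - 1) ε) := by
  have hn0 : 0 < n := by omega
  have hm := h.mono hn
  have he : 0 < exposedIndex n j ∧ exposedIndex n j < n := by
    unfold exposedIndex; omega
  have hinj := h.injOn_moonPt hn0
  set S := remainingLabels n j (exposedIndex n j) with hSdef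
  have hS : S ⊆ moonLabels n := fun x hx => hx.1
  have hf : Set.MapsTo (closeGap j) S (moonLabels (n - 1)) := mapsTo_closeGap hj
  have hne : ∀ x ∈ S, x.1 ≠ j := fun x hx => ne_of_mem_remainingLabels hx
  have hcoe := h.coe_erase_erase hn0 hj he
  set π : ℝ × ℝ → ℝ × ℝ := fun p =>
    moonPt (n - 1) ε (closeGap j (Function.invFunOn (moonPt n ε) (moonLabels n) p)) with hπdef
  have hπ : ∀ x ∈ S, π (moonPt n ε x) = moonPt (n - 1) ε (closeGap j x) := fun x hx => by
    rw [hπdef]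
    dsimp only
    rw [hinj.leftInvOn_invFunOn (hS hx)]
  have hmem : ∀ p ∈ ((moonPts n ε).erase (moonPt n ε (j, false))).erase
      (moonPt n ε (exposedIndex n j, true)), ∃ x ∈ S, moonPt n ε x = p := fun p hp => by
    rwa [← Finset.mem_coe, hcoe] at hp
  refine ⟨π, ?_, ?_, 1, Or.inl rfl, ?_⟩
  · rw [hcoe, coe_moonPts]
    refine ⟨?_, ?_, ?_⟩
    · rintro _ ⟨x, hx, rfl⟩
      rw [hπ x hx]
      exact ⟨_, hf hx, rfl⟩
    · rintro _ ⟨x, hx, rfl⟩ _ ⟨y, hy, rfl⟩ hxy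
      rw [hπ x hx, hπ y hy] at hxy
      rw [injOn_closeGap (hne x hx) (hne y hy)
        (hm.injOn_moonPt (by omega) (hf hx) (hf hy) hxy)]
    · rintro _ ⟨y, hy, rfl⟩
      obtain ⟨x, hx, rfl⟩ := surjOn_closeGap hn hj hy
      exact ⟨_, ⟨x, hx, rfl⟩, hπ x hx⟩
  · intro p hp
    obtain ⟨x, hx, rfl⟩ := hmem p hp
    rw [hπ x hx, moonW_moonPt (by omega) hm (hf hx), moonW_moonPt hn0 h (hS hx)]
    rfl
  · intro p hp q hq r hr hpq hpr hqr
    obtain ⟨x, hx, rfl⟩ := hmem p hp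
    obtain ⟨y, hy, rfl⟩ := hmem q hq
    obtain ⟨z, hz, rfl⟩ := hmem r hr
    have key := orientDet_mul_orientDet_pos h hm hS hf
      (fun x hx y hy => closeGap_lt (hne x hx) (hne y hy))
      (fun x _ y _ hxy => by simp only [closeGap, hxy]) (fun _ => rfl) hx hy hz
      (ne_of_apply_ne _ hpq) (ne_of_apply_ne _ hpr) (ne_of_apply_ne _ hqr)
    rw [hπ x hx, hπ y hy, hπ z hz, one_mul]
    unfold orient
    rcases pos_and_pos_or_neg_and_neg_of_mul_pos key with ⟨h1, h2⟩ | ⟨h1, h2⟩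
    · rw [Real.sign_of_pos h1, Real.sign_of_pos h2]
    · rw [Real.sign_of_neg h1, Real.sign_of_neg h2]

/-- For `n ≥ 3` and admissible `ε` with the moon `𝓛ₙ` in general position:
(a) for every green point `g`, exactly one red point of `𝓛ₙ` is extremal in `𝓛ₙ \ {g}`;
(b) for that red point `r`, the cake `𝓛ₙ \ {g, r}` is order-equivalent to a moon `𝓛ₙ₋₁`
built with some admissible `ε'`. -/
theorem statement14 (n : ℕ) (hn : 3 ≤ n) (ε : ℝ)
    (hε0 : 0 < ε) (hε1 : ε < 1 - Real.cos (Real.pi / (2 * n)))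
    (hgp : GenPos (↑(moonPts n ε) : Set (ℝ × ℝ))) :
    ∀ g ∈ moonGreens n,
      (∃! r, r ∈ moonReds n ε ∧ r ∈ exPts ((moonPts n ε).erase g)) ∧
      (∀ r, r ∈ moonReds n ε → r ∈ exPts ((moonPts n ε).erase g) →
        ∃ ε' : ℝ, 0 < ε' ∧ ε' < 1 - Real.cos (Real.pi / (2 * (n - 1 : ℕ))) ∧
          OrderEquivCakes (((moonPts n ε).erase g).erase r) (moonPts (n - 1) ε')
            (moonW n ε) (moonW (n - 1) ε')) := by
  have h : MoonAdmissible n ε := ⟨hε0, hε1⟩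
  have hn0 : 0 < n := by omega
  intro g hg
  obtain ⟨j, hj, rfl⟩ := (mem_moonGreens ε).1 hg
  have he : 0 < exposedIndex n j ∧ exposedIndex n j < n := by
    unfold exposedIndex; omega
  have huniq : ∀ r, r ∈ moonReds n ε →
      r ∈ exPts ((moonPts n ε).erase (moonPt n ε (j, false))) →
      r = moonPt n ε (exposedIndex n j, true) := by
    intro r hr hex
    obtain ⟨k, hk, rfl⟩ := mem_moonReds.1 hr
    rw [h.red_mem_exPts_iff hn0 hj hk] at hex
    by_contra hne
    exact hex (h.red_mem_convexHull hk fun hke => hne (by rw [hke]))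
  refine ⟨⟨_, ⟨mem_moonReds.2 ⟨_, he, rfl⟩, ?_⟩, fun r hr => huniq r hr.1 hr.2⟩, ?_⟩
  · exact (h.red_mem_exPts_iff hn0 hj he).2 (h.exposed_notMem_convexHull hn hj)
  · intro r hr hex
    rw [huniq r hr hex]
    exact ⟨ε, hε0, (h.mono hn).2, orderEquivCakes_moonPts hn hj h⟩

end
end
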